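/- arXiv:1911.05005 — 10 statements merged into one kernel-verified Lean document; each statement's English description precedes it below -/
import Mathlib

section
/- Let (Q,·) be an involutory latin quandle and fix e ∈ Q. Define x + y = (x/e)·(e·y), where / denotes right division in (Q,·). Then (Q,+) is a uniquely 2-divisible left Bruck loop with identity element e; moreover, in (Q,+) the two-sided inverse of x is e·x, and x + x = x·e. -/
/-- An involutory latin quandle: a quasigroup (all left and right translations
bijective) that is idempotent, left distributive and whose left translations are
involutions. -/
structure IsInvolutoryLatinQuandle {Q : Type*} (mul : Q → Q → Q) : Prop where
  leftBij : ∀ x, Function.Bijective (fun y => mul x y)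
  rightBij : ∀ x, Function.Bijective (fun y => mul y x)
  idem : ∀ x, mul x x = x
  leftDistrib : ∀ x y z, mul x (mul y z) = mul (mul x y) (mul x z)
  invol : ∀ x y, mul x (mul x y) = y

structure IsLoop {Q : Type*} (mul : Q → Q → Q) (e : Q) : Prop where
  leftBij : ∀ x, Function.Bijective (fun y => mul x y)
  rightBij : ∀ x, Function.Bijective (fun y => mul y x)
  one_mul : ∀ x, mul e x = x
  mul_one : ∀ x, mul x e = x

/-- A left Bol loop: a loop satisfying the left Bol identity. -/
structure IsLeftBolLoop {Q : Type*} (mul : Q → Q → Q) (e : Q) extends IsLoop mul e : Prop where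
  leftBol : ∀ x y z, mul x (mul y (mul x z)) = mul (mul x (mul y x)) z

/-- A left Bruck loop: a left Bol loop with two-sided inverses (given by `inv`)
satisfying the automorphic inverse property. -/
structure IsLeftBruckLoop {Q : Type*} (mul : Q → Q → Q) (e : Q) (inv : Q → Q)
    extends IsLeftBolLoop mul e : Prop where
  mul_inv : ∀ x, mul x (inv x) = e
  inv_mul : ∀ x, mul (inv x) x = e
  aip : ∀ x y, inv (mul x y) = mul (inv x) (inv y)

/-- Theorem 3.1(i) (Kikkawa, Robinson): if `(Q,·)` is an involutory latin quandle,
`e ∈ Q`, and `x + y = (x/e)·(e·y)` (where `/` is right division in the quandle),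
then `(Q,+)` is a uniquely 2-divisible left Bruck loop with identity `e`, the
two-sided inverse of `x` is `e·x`, and `x + x = x·e`. -/
theorem quandle_to_bruck {Q : Type*} (mul : Q → Q → Q)
    (hQ : IsInvolutoryLatinQuandle mul) (e : Q)
    (rdiv : Q → Q → Q) (hrdiv : ∀ x y, mul (rdiv x y) y = x)
    (add : Q → Q → Q) (hadd : ∀ x y, add x y = mul (rdiv x e) (mul e y)) :
    IsLeftBruckLoop add e (fun x => mul e x) ∧
    Function.Bijective (fun x => add x x) ∧
    (∀ x, add x x = mul x e) := by
  obtain ⟨hl, hr, idem, dist, invol⟩ := hQ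
  have rdiv_eq : ∀ {u x}, mul u e = x → rdiv x e = u := fun {u x} h =>
    (hr e).injective ((hrdiv x e).trans h.symm)
  have rdiv_self : rdiv e e = e := rdiv_eq (idem e)
  have rdiv_inv : ∀ x, rdiv (mul e x) e = mul e (rdiv x e) := fun x => rdiv_eq <| by
    have h := dist e (rdiv x e) e
    rw [idem, hrdiv] at h
    exact h.symm
  have rdiv_bij : Function.Bijective (fun x => rdiv x e) :=
    ⟨fun x y h => by
      have h' : rdiv x e = rdiv y e := h
      rw [← hrdiv x e, h', hrdiv], fun u => ⟨mul u e, rdiv_eq rfl⟩⟩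
  have rdiv_mul_self : ∀ x, mul (rdiv x e) x = e := fun x => by
    conv_lhs => rw [← hrdiv x e, rdiv_eq rfl]
    exact invol _ _
  have conj : ∀ x y z, mul (mul x y) z = mul x (mul y (mul x z)) := fun x y z => by
    rw [dist x y (mul x z), invol]
  have add_self : ∀ x, add x x = mul x e := fun x => by
    rw [hadd, dist, hrdiv, rdiv_mul_self]
  refine ⟨{ leftBij := ?_, rightBij := ?_, one_mul := ?_, mul_one := ?_, leftBol := ?_,
            mul_inv := ?_, inv_mul := ?_, aip := ?_ }, ?_, add_self⟩
  · intro x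
    simp only [hadd]
    exact (hl (rdiv x e)).comp (hl e)
  · intro y
    simp only [hadd]
    exact (hr (mul e y)).comp rdiv_bij
  · intro x
    rw [hadd, rdiv_self, invol]
  · intro x
    rw [hadd, idem, hrdiv]
  · intro x y z
    have h : rdiv (add x (add y x)) e = mul (rdiv x e) (mul e (rdiv y e)) := rdiv_eq <| by
      rw [hadd, hadd, conj, conj, hrdiv]
    rw [hadd (add x (add y x)), h]
    simp only [hadd, conj]
  · intro x
    simp only [hadd, invol, rdiv_mul_self]
  · intro x
    simp only [hadd, rdiv_inv]
    rw [← dist, rdiv_mul_self, idem]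
  · intro x y
    simp only [hadd, rdiv_inv]
    rw [dist]
  · simp only [add_self]
    exact hr e
end

section
/- Let (Q,+) be a uniquely 2-divisible left Bruck loop with identity element e. Define x·y = (x+x) − y, i.e. x·y = (x+x) + (−y) where −y is the two-sided inverse of y. Then (Q,·) is an involutory latin quandle. -/
namespace IsLeftBruckLoop

variable {Q : Type*} {add : Q → Q → Q} {e : Q} {neg : Q → Q}

theorem neg_add_cancel_left (h : IsLeftBruckLoop add e neg) (x z : Q) :
    add (neg x) (add x z) = z := by
  apply (h.leftBij x).injective
  change add x (add (neg x) (add x z)) = add x z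
  rw [h.leftBol, h.inv_mul, h.mul_one]

theorem neg_neg (h : IsLeftBruckLoop add e neg) (x : Q) : neg (neg x) = x := by
  apply (h.leftBij (neg x)).injective
  change add (neg x) (neg (neg x)) = add (neg x) x
  rw [h.mul_inv, h.inv_mul]

theorem add_neg_cancel_left (h : IsLeftBruckLoop add e neg) (x z : Q) :
    add x (add (neg x) z) = z := by
  simpa only [h.neg_neg] using h.neg_add_cancel_left (neg x) z

theorem add_self_add (h : IsLeftBruckLoop add e neg) (x z : Q) :
    add (add x x) z = add x (add x z) := by
  simpa only [h.one_mul] using (h.leftBol x e z).symm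

/-- The square of a sum: translating by `x + y` twice is translating by `x`, `y`, `y`, `x`. -/
theorem add_add_add_add (h : IsLeftBruckLoop add e neg) (x y z : Q) :
    add (add x y) (add (add x y) z) = add x (add y (add y (add x z))) := by
  have translate (w : Q) : add (add x (add (add y y) x)) w = add x (add y (add y (add x w))) := by
    rw [← h.leftBol, h.add_self_add]
  have eval : add (add x (add (add y y) x)) (neg (add x y)) = add x y := by
    rw [translate, h.aip, h.add_neg_cancel_left, h.mul_inv, h.mul_one]
  have key := h.leftBol (neg (add x y)) (add x (add (add y y) x)) (add (add x y) z)
  rw [eval, h.inv_mul, h.one_mul, h.neg_add_cancel_left, translate] at key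
  rw [← key, h.add_neg_cancel_left]

end IsLeftBruckLoop

/-- Theorem 3.1(ii) (Kikkawa, Robinson): if `(Q,+)` is a uniquely 2-divisible left
Bruck loop with identity `e` and `x·y = (x+x) + (−y)`, then `(Q,·)` is an
involutory latin quandle. -/
theorem bruck_to_quandle {Q : Type*} (add : Q → Q → Q) (e : Q) (neg : Q → Q)
    (hB : IsLeftBruckLoop add e neg)
    (h2div : Function.Bijective (fun x => add x x))
    (mul : Q → Q → Q) (hmul : ∀ x y, mul x y = add (add x x) (neg y)) :
    IsInvolutoryLatinQuandle mul := by
  have invol (x y : Q) : mul x (mul x y) = y := by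
    rw [hmul, hmul, hB.aip, hB.neg_neg, hB.add_neg_cancel_left]
  refine ⟨fun x => (show Function.Involutive (mul x) from invol x).bijective, fun x => ?_,
    fun x => ?_, fun x y z => ?_, invol⟩
  · simp only [hmul]
    exact (hB.rightBij (neg x)).comp h2div
  · rw [hmul, hB.add_self_add, hB.mul_inv, hB.mul_one]
  · simp only [hmul]
    rw [hB.add_self_add (add (add x x) (neg y)), hB.add_add_add_add]
    simp only [hB.aip, hB.neg_neg]
    rw [← hB.aip x x, hB.add_neg_cancel_left, hB.add_self_add (neg y)]
end

section
/- Let (Q,+) be a uniquely 2-divisible left Bruck loop with identity element e, let (Q,·) be defined by x·y = (x+x) + (−y), and let (Q,∘) be defined by x ∘ y = (x/e)·(e·y), where / is right division in (Q,·). Then x ∘ y = x + y for all x, y ∈ Q. -/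
theorem IsLeftBruckLoop.inv_one {Q : Type*} {mul : Q → Q → Q} {e : Q} {inv : Q → Q}
    (h : IsLeftBruckLoop mul e inv) : inv e = e := by
  rw [← h.one_mul (inv e), h.mul_inv]

theorem IsLeftBruckLoop.inv_inv {Q : Type*} {mul : Q → Q → Q} {e : Q} {inv : Q → Q}
    (h : IsLeftBruckLoop mul e inv) (x : Q) : inv (inv x) = x :=
  (h.leftBij (inv x)).injective ((h.mul_inv (inv x)).trans (h.inv_mul x).symm)


/-- Theorem 3.1(iii), first half: starting from a uniquely 2-divisible left Bruck
loop `(Q,+)` with identity `e`, forming the quandle operation `x·y = (x+x) + (−y)`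
and then the loop operation `x ∘ y = (x/e)·(e·y)` (with `/` the right division of
`(Q,·)`) recovers the original operation: `x ∘ y = x + y`. -/
theorem bruck_quandle_bruck {Q : Type*} (add : Q → Q → Q) (e : Q) (neg : Q → Q)
    (hB : IsLeftBruckLoop add e neg)
    (h2div : Function.Bijective (fun x => add x x))
    (mul : Q → Q → Q) (hmul : ∀ x y, mul x y = add (add x x) (neg y))
    (rdiv : Q → Q → Q) (hrdiv : ∀ x y, mul (rdiv x y) y = x)
    (comp : Q → Q → Q) (hcomp : ∀ x y, comp x y = mul (rdiv x e) (mul e y)) :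
    ∀ x y, comp x y = add x y := by
  intro x y
  have hx := hrdiv x e
  rw [hmul, hB.inv_one, hB.mul_one] at hx
  rw [hcomp, hmul (rdiv x e), hx, hmul e y, hB.one_mul, hB.one_mul, hB.inv_inv]
end

section
/- Let (Q,·) be an involutory latin quandle, fix e ∈ Q, let (Q,+) be defined by x + y = (x/e)·(e·y) (where / is right division in (Q,·)), and let (Q,∗) be defined by x ∗ y = (x+x) + (−y), where −y is the two-sided inverse of y in the loop (Q,+). Then x ∗ y = x·y for all x, y ∈ Q. -/
/-- Theorem 3.1(iii), second half: starting from an involutory latin quandle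
`(Q,·)`, forming the loop operation `x + y = (x/e)·(e·y)` (with `/` the right
division of `(Q,·)`) and then the operation `x ∗ y = (x+x) + (−y)` (with `−y` the
two-sided inverse of `y` in `(Q,+)`) recovers the quandle: `x ∗ y = x·y`. -/
theorem quandle_bruck_quandle {Q : Type*} (mul : Q → Q → Q)
    (hQ : IsInvolutoryLatinQuandle mul) (e : Q)
    (rdiv : Q → Q → Q) (hrdiv : ∀ x y, mul (rdiv x y) y = x)
    (add : Q → Q → Q) (hadd : ∀ x y, add x y = mul (rdiv x e) (mul e y))
    (neg : Q → Q) (hneg : ∀ x, add x (neg x) = e ∧ add (neg x) x = e) :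
    ∀ x y, add (add x x) (neg y) = mul x y := by
  intro x y
  have hneg_eq : neg y = mul e y := by
    apply (hQ.leftBij e).1
    apply (hQ.leftBij (rdiv y e)).1
    have h₁ := (hneg y).1
    have h₂ := hQ.invol (rdiv y e) e
    rw [hadd] at h₁
    rw [hrdiv] at h₂
    simp only [hQ.invol, h₁, h₂]
  have hdouble : rdiv (add x x) e = x := by
    apply (hQ.rightBij e).1
    have h₁ := hQ.leftDistrib (rdiv x e) e (mul (rdiv x e) e)
    rw [hQ.invol, hrdiv] at h₁
    simp only [hrdiv, hadd, h₁]
  rw [hadd, hdouble, hneg_eq, hQ.invol]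
end

section
/- Let F be a loop, A an abelian group, and θ : F × F → A a loop cocycle. Then the loop Q(F,A,θ) is a left Bol loop if and only if F is a left Bol loop and θ(x,z) + θ(y,xz) + θ(x, y(xz)) = θ(y,x) + θ(x,yx) + θ(x(yx), z) holds for all x, y, z ∈ F. -/
/-- The multiplication of the central extension \`Q(F,A,θ)\`:
\`(x,a)(y,b) = (xy, a + b + θ(x,y))\`. -/
def qmul {F A : Type*} [AddCommGroup A] (mul : F → F → F) (θ : F → F → A) :
    F × A → F × A → F × A :=
  fun p q => (mul p.1 q.1, p.2 + q.2 + θ p.1 q.1)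

/-- A loop cocycle on a loop `F` makes `Q(F,A,θ)` a loop. -/
theorem IsLoop.qmul {F A : Type*} [AddCommGroup A] {mul : F → F → F} {one : F}
    (hF : IsLoop mul one) {θ : F → F → A} (hθ : ∀ x, θ x one = 0 ∧ θ one x = 0) :
    IsLoop (qmul mul θ) (one, (0 : A)) where
  leftBij := by
    rintro ⟨x, a⟩
    refine ⟨?_, ?_⟩
    · rintro ⟨y, b⟩ ⟨z, c⟩ h
      obtain ⟨h₁, h₂⟩ := Prod.mk.inj h
      obtain rfl : y = z := (hF.leftBij x).1 h₁
      simpa using h₂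
    · rintro ⟨z, c⟩
      obtain ⟨y, rfl⟩ := (hF.leftBij x).2 z
      exact ⟨(y, c - a - θ x y), Prod.ext rfl (by simp only [_root_.qmul]; abel)⟩
  rightBij := by
    rintro ⟨x, a⟩
    refine ⟨?_, ?_⟩
    · rintro ⟨y, b⟩ ⟨z, c⟩ h
      obtain ⟨h₁, h₂⟩ := Prod.mk.inj h
      obtain rfl : y = z := (hF.rightBij x).1 h₁
      simpa using h₂
    · rintro ⟨z, c⟩
      obtain ⟨y, rfl⟩ := (hF.rightBij x).2 z
      exact ⟨(y, c - a - θ y x), Prod.ext rfl (by simp only [_root_.qmul]; abel)⟩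
  one_mul := fun x => Prod.ext (hF.one_mul x.1) (by simp [_root_.qmul, hθ])
  mul_one := fun x => Prod.ext (hF.mul_one x.1) (by simp [_root_.qmul, hθ])

/-- Lemma 5.1: for a loop `F`, an abelian group `A` and a loop cocycle `θ`, the
loop `Q(F,A,θ)` is a left Bol loop if and only if `F` is a left Bol loop and the
left Bol cocycle identity
`θ(x,z) + θ(y,xz) + θ(x,y(xz)) = θ(y,x) + θ(x,yx) + θ(x(yx),z)` holds. -/
theorem leftBol_cocycle {F A : Type*} [AddCommGroup A]
    (mul : F → F → F) (one : F) (hF : IsLoop mul one)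
    (θ : F → F → A) (hθ : ∀ x, θ x one = 0 ∧ θ one x = 0) :
    IsLeftBolLoop (qmul mul θ) (one, (0 : A)) ↔
      (IsLeftBolLoop mul one ∧
        ∀ x y z, θ x z + θ y (mul x z) + θ x (mul y (mul x z)) =
          θ y x + θ x (mul y x) + θ (mul x (mul y x)) z) := by
  refine ⟨fun h => ⟨⟨hF, fun x y z => ?_⟩, fun x y z => ?_⟩, fun ⟨h, hc⟩ => ⟨hF.qmul hθ, ?_⟩⟩
  · exact congrArg Prod.fst (h.leftBol (x, 0) (y, 0) (z, 0))
  · simpa [qmul] using congrArg Prod.snd (h.leftBol (x, 0) (y, 0) (z, 0))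
  · rintro ⟨x, a⟩ ⟨y, b⟩ ⟨z, c⟩
    refine Prod.ext (h.leftBol x y z) ?_
    have hxyz := congrArg (a + b + a + c + ·) (hc x y z)
    dsimp only [qmul] at hxyz ⊢
    convert hxyz using 1 <;> abel
end

section
/- Let F be a loop, A an abelian group, and θ : F × F → A a loop cocycle. Then every element of the loop Q(F,A,θ) has a two-sided inverse if and only if every element of F has a two-sided inverse and θ(x, x⁻¹) = θ(x⁻¹, x) holds for every x ∈ F; in that case the two-sided inverse of (x,a) in Q(F,A,θ) is (x⁻¹, −a − θ(x, x⁻¹)). -/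
/-- If `y` is a two-sided inverse of `x` on which `θ` is symmetric, then `(y, -a - θ x y)` is a
two-sided inverse of `(x, a)` in `Q(F,A,θ)`. -/
theorem qmul_inverse {F A : Type*} [AddCommGroup A] {mul : F → F → F} {one x y : F}
    {θ : F → F → A} (hxy : mul x y = one) (hyx : mul y x = one) (hθ : θ x y = θ y x) (a : A) :
    qmul mul θ (x, a) (y, -a - θ x y) = (one, 0) ∧
      qmul mul θ (y, -a - θ x y) (x, a) = (one, 0) := by
  refine ⟨Prod.ext hxy ?_, Prod.ext hyx ?_⟩
  · change a + (-a - θ x y) + θ x y = 0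
    abel
  · change -a - θ x y + a + θ y x = 0
    rw [hθ]
    abel

/-- Lemma 5.2(i): for a loop `F`, an abelian group `A` and a loop cocycle `θ`,
every element of `Q(F,A,θ)` has a two-sided inverse if and only if every element
of `F` has a two-sided inverse `x⁻¹` with `θ(x,x⁻¹) = θ(x⁻¹,x)`; in that case the
two-sided inverse of `(x,a)` is `(x⁻¹, −a − θ(x,x⁻¹))`. -/
theorem qmul_twoSidedInverses_iff {F A : Type*} [AddCommGroup A]
    (mul : F → F → F) (one : F) (hF : IsLoop mul one)
    (θ : F → F → A) (hθ : ∀ x, θ x one = 0 ∧ θ one x = 0) :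
    ((∀ p : F × A, ∃ q, qmul mul θ p q = (one, (0 : A)) ∧
        qmul mul θ q p = (one, (0 : A))) ↔
      (∀ x : F, ∃ y, mul x y = one ∧ mul y x = one ∧ θ x y = θ y x)) ∧
    (∀ finv : F → F,
      (∀ x, mul x (finv x) = one ∧ mul (finv x) x = one ∧ θ x (finv x) = θ (finv x) x) →
      ∀ (x : F) (a : A),
        qmul mul θ (x, a) (finv x, -a - θ x (finv x)) = (one, (0 : A)) ∧
        qmul mul θ (finv x, -a - θ x (finv x)) (x, a) = (one, (0 : A))) := by
  refine ⟨⟨fun h x => ?_, fun h p => ?_⟩, fun finv h x a =>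
    qmul_inverse (h x).1 (h x).2.1 (h x).2.2 a⟩
  · obtain ⟨⟨y, b⟩, hl, hr⟩ := h (x, 0)
    simp only [qmul, Prod.mk.injEq, zero_add, add_zero] at hl hr
    exact ⟨y, hl.1, hr.1, add_left_cancel (hl.2.trans hr.2.symm)⟩
  · obtain ⟨y, hxy, hyx, hθxy⟩ := h p.1
    exact ⟨_, qmul_inverse hxy hyx hθxy p.2⟩
end

section
/- Let F be a loop, A an abelian group, and θ : F × F → A a loop cocycle. Then the loop Q(F,A,θ) has two-sided inverses and satisfies the automorphic inverse property if and only if F has two-sided inverses and satisfies the automorphic inverse property, θ(x, x⁻¹) = θ(x⁻¹, x) holds for every x ∈ F, and θ(x,x⁻¹) + θ(y,y⁻¹) = θ(x,y) + θ(x⁻¹,y⁻¹) + θ(xy, (xy)⁻¹) holds for all x, y ∈ F. -/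
/-- Lemma 5.2(ii): for a loop `F`, an abelian group `A` and a loop cocycle `θ`,
the loop `Q(F,A,θ)` has two-sided inverses and the automorphic inverse property
if and only if `F` has two-sided inverses and the automorphic inverse property,
`θ(x,x⁻¹) = θ(x⁻¹,x)`, and
`θ(x,x⁻¹) + θ(y,y⁻¹) = θ(x,y) + θ(x⁻¹,y⁻¹) + θ(xy,(xy)⁻¹)`. -/
theorem qmul_aip_iff {F A : Type*} [AddCommGroup A]
    (mul : F → F → F) (one : F) (hF : IsLoop mul one)
    (θ : F → F → A) (hθ : ∀ x, θ x one = 0 ∧ θ one x = 0) :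
    (∃ qinv : F × A → F × A,
      (∀ p, qmul mul θ p (qinv p) = (one, (0 : A))) ∧
      (∀ p, qmul mul θ (qinv p) p = (one, (0 : A))) ∧
      (∀ p q, qinv (qmul mul θ p q) = qmul mul θ (qinv p) (qinv q))) ↔
    (∃ finv : F → F,
      (∀ x, mul x (finv x) = one) ∧
      (∀ x, mul (finv x) x = one) ∧
      (∀ x y, finv (mul x y) = mul (finv x) (finv y)) ∧
      (∀ x, θ x (finv x) = θ (finv x) x) ∧
      (∀ x y, θ x (finv x) + θ y (finv y) =
        θ x y + θ (finv x) (finv y) + θ (mul x y) (finv (mul x y)))) := by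
  constructor
  · rintro ⟨qinv, hr, hl, haip⟩
    obtain ⟨finv, hfinv⟩ : ∃ finv : F → F, ∀ x, finv x = (qinv (x, 0)).1 :=
      ⟨_, fun _ => rfl⟩
    have hmul : ∀ p : F × A, mul p.1 (qinv p).1 = one := fun p => congrArg Prod.fst (hr p)
    have hq : ∀ x a, qinv (x, a) = (finv x, -a - θ x (finv x)) := by
      intro x a
      have h1 : (qinv (x, a)).1 = finv x :=
        (hF.leftBij x).1 ((hmul (x, a)).trans (by rw [hfinv]; exact (hmul (x, 0)).symm))
      have h2 : a + (qinv (x, a)).2 + θ x (qinv (x, a)).1 = 0 := congrArg Prod.snd (hr (x, a))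
      rw [h1] at h2
      refine Prod.ext h1 ?_
      linear_combination (norm := module) h2
    simp only [Prod.forall, qmul, hq, Prod.mk.injEq] at hr hl haip
    refine ⟨finv, fun x => (hr x 0).1, fun x => (hl x 0).1, fun x y => (haip x 0 y 0).1,
      fun x => ?_, fun x y => ?_⟩
    · linear_combination (norm := module) -(hl x 0).2
    · linear_combination (norm := module) (haip x 0 y 0).2
  · rintro ⟨finv, hr, hl, haip, hcomm, hθinv⟩
    refine ⟨fun p => (finv p.1, -p.2 - θ p.1 (finv p.1)), fun p => ?_, fun p => ?_,
      fun p q => ?_⟩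
    · exact Prod.ext (hr p.1) (by simp only [qmul]; abel)
    · exact Prod.ext (hl p.1) (by simp only [qmul, hcomm]; abel)
    · refine Prod.ext (haip p.1 q.1) ?_
      simp only [qmul]
      linear_combination (norm := module) hθinv p.1 q.1
end

section
/- Let F be a loop, A an abelian group, and θ : F × F → A a loop cocycle. Then the loop Q(F,A,θ) is left automorphic if and only if F is left automorphic and θ(x,z) + θ(x,u) + θ(y,xz) + θ(y,xu) + θ(yx, L_{x,y}(zu)) + θ(L_{x,y}(z), L_{x,y}(u)) = θ(z,u) + θ(y,x) + θ(x,zu) + θ(y, x(zu)) + θ(yx, L_{x,y}(z)) + θ(yx, L_{x,y}(u)) holds for all x, y, z, u ∈ F, where L_{x,y}(z) = (yx)\(y(xz)). -/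
/-- Left inner mappings of a loop are bijective. -/
theorem IsLoop.bijective_leftInner {F : Type*} {mul : F → F → F} {one : F}
    (hF : IsLoop mul one) {x y : F} {f : F → F}
    (hf : ∀ z, mul (mul y x) (f z) = mul y (mul x z)) : Function.Bijective f := by
  have h : Function.Bijective ((fun z => mul (mul y x) z) ∘ f) := by
    have : (fun z => mul (mul y x) z) ∘ f = (fun z => mul y z) ∘ fun z => mul x z :=
      funext hf
    rw [this]
    exact (hF.leftBij y).comp (hF.leftBij x)
  exact (Function.Bijective.of_comp_iff' (hF.leftBij (mul y x)) f).1 h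

/-- A map of a product that acts by `f` on the first factor and by translations on the
second is bijective when `f` is. -/
theorem bijective_prod_translate {F A : Type*} [AddCommGroup A] {f : F → F}
    (hf : Function.Bijective f) (g : F → A) :
    Function.Bijective (fun r : F × A => (f r.1, r.2 + g r.1)) := by
  refine ⟨fun ⟨z, c⟩ ⟨w, d⟩ h => ?_, fun ⟨w, d⟩ => ?_⟩
  · simp only [Prod.mk.injEq] at h
    obtain rfl := hf.1 h.1
    simpa using h.2
  · obtain ⟨z, rfl⟩ := hf.2 w
    exact ⟨(z, d - g z), by simp⟩

/-- The left inner mapping of `Q(F,A,θ)` in coordinates. -/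
theorem leftInner_qmul_eq {F A : Type*} [AddCommGroup A] {mul : F → F → F} {one : F}
    (hF : IsLoop mul one) {θ : F → F → A} {p q r s : F × A} {w : F}
    (hw : mul (mul q.1 p.1) w = mul q.1 (mul p.1 r.1))
    (hs : qmul mul θ (qmul mul θ q p) s = qmul mul θ q (qmul mul θ p r)) :
    s = (w, r.2 + (θ p.1 r.1 + θ q.1 (mul p.1 r.1) - θ q.1 p.1 - θ (mul q.1 p.1) w)) := by
  obtain ⟨v, d⟩ := s
  simp only [qmul, Prod.mk.injEq] at hs
  obtain rfl : v = w := (hF.leftBij (mul q.1 p.1)).1 (hs.1.trans hw.symm)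
  refine Prod.ext rfl ?_
  have h := hs.2
  rw [← sub_eq_zero] at h ⊢
  rw [← h]
  simp only
  abel

/-- Lemma 5.5: for a loop `F`, an abelian group `A` and a loop cocycle `θ`, the
loop `Q(F,A,θ)` is left automorphic (all left inner mappings
`L_{p,q} = L_{qp}⁻¹ ∘ L_q ∘ L_p` are automorphisms) if and only if `F` is left
automorphic and the left automorphic cocycle identity holds. Here `ldiv` is left
division in `F`, `qldiv` is left division in `Q(F,A,θ)`, `Lin x y` is the left
inner mapping `L_{x,y}(z) = (yx)\(y(xz))` of `F`, and `QLin p q` is the left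
inner mapping of `Q(F,A,θ)`. -/
theorem qmul_leftAutomorphic_iff {F A : Type*} [AddCommGroup A]
    (mul : F → F → F) (one : F) (hF : IsLoop mul one)
    (θ : F → F → A) (hθ : ∀ x, θ x one = 0 ∧ θ one x = 0)
    (ldiv : F → F → F) (hldiv : ∀ x y, mul x (ldiv x y) = y)
    (Lin : F → F → F → F)
    (hLin : ∀ x y z, Lin x y z = ldiv (mul y x) (mul y (mul x z)))
    (qldiv : F × A → F × A → F × A)
    (hqldiv : ∀ p q, qmul mul θ p (qldiv p q) = q)
    (QLin : F × A → F × A → F × A → F × A)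
    (hQLin : ∀ p q r, QLin p q r =
      qldiv (qmul mul θ q p) (qmul mul θ q (qmul mul θ p r))) :
    (∀ p q : F × A, Function.Bijective (QLin p q) ∧
        ∀ r s, QLin p q (qmul mul θ r s) = qmul mul θ (QLin p q r) (QLin p q s)) ↔
      ((∀ x y : F, Function.Bijective (Lin x y) ∧
          ∀ z u, Lin x y (mul z u) = mul (Lin x y z) (Lin x y u)) ∧
        (∀ x y z u : F,
          θ x z + θ x u + θ y (mul x z) + θ y (mul x u) +
            θ (mul y x) (Lin x y (mul z u)) + θ (Lin x y z) (Lin x y u) =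
          θ z u + θ y x + θ x (mul z u) + θ y (mul x (mul z u)) +
            θ (mul y x) (Lin x y z) + θ (mul y x) (Lin x y u))) := by
  have hL : ∀ x y z, mul (mul y x) (Lin x y z) = mul y (mul x z) := fun x y z => by
    rw [hLin, hldiv]
  have hQ : ∀ p q r, QLin p q r = (Lin p.1 q.1 r.1, r.2 + (θ p.1 r.1 +
      θ q.1 (mul p.1 r.1) - θ q.1 p.1 - θ (mul q.1 p.1) (Lin p.1 q.1 r.1))) :=
    fun p q r => leftInner_qmul_eq hF (hL _ _ _) (by rw [hQLin, hqldiv])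
  have hLbij : ∀ x y, Function.Bijective (Lin x y) := fun x y =>
    hF.bijective_leftInner (hL x y)
  have hQbij : ∀ p q, Function.Bijective (QLin p q) := fun p q => by
    rw [funext (hQ p q)]
    exact bijective_prod_translate (hLbij p.1 q.1) fun z =>
      θ p.1 z + θ q.1 (mul p.1 z) - θ q.1 p.1 - θ (mul q.1 p.1) (Lin p.1 q.1 z)
  simp only [hLbij, hQbij, true_and]
  constructor
  · intro h
    have key := fun x y z u => h (x, 0) (y, 0) (z, 0) (u, 0)
    simp only [hQ, qmul, Prod.mk.injEq] at key
    refine ⟨fun x y z u => (key x y z u).1, fun x y z u => ?_⟩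
    have h2 := (key x y z u).2
    rw [eq_comm, ← sub_eq_zero] at h2
    rw [← sub_eq_zero, ← h2]
    abel
  · rintro ⟨hmul, hco⟩ ⟨x, a⟩ ⟨y, b⟩ ⟨z, c⟩ ⟨u, d⟩
    simp only [hQ, qmul, Prod.mk.injEq]
    refine ⟨hmul x y z u, ?_⟩
    have h2 := hco x y z u
    rw [← sub_eq_zero] at h2
    rw [eq_comm, ← sub_eq_zero, ← h2]
    abel
end

section
/- Let F be a loop, A an abelian group, and θ : F × F → A a loop cocycle. Then the loop Q(F,A,θ) is a commutative automorphic loop if and only if F is a commutative automorphic loop, θ(x,y) = θ(y,x) holds for all x, y ∈ F, and θ(x,z) + θ(x,u) + θ(y,xz) + θ(y,xu) + θ(yx, L_{x,y}(zu)) + θ(L_{x,y}(z), L_{x,y}(u)) = θ(z,u) + θ(y,x) + θ(x,zu) + θ(y, x(zu)) + θ(yx, L_{x,y}(z)) + θ(yx, L_{x,y}(u)) holds for all x, y, z, u ∈ F, where L_{x,y}(z) = (yx)\(y(xz)). -/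
theorem IsLoop.ldiv_eq_of_mul_eq {Q : Type*} {mul : Q → Q → Q} {e : Q} (hQ : IsLoop mul e)
    {ldiv : Q → Q → Q} (hldiv : ∀ x y, mul x (ldiv x y) = y) {x y z : Q} (h : mul x z = y) :
    ldiv x y = z :=
  (hQ.leftBij x).1 ((hldiv x y).trans h.symm)

/-- Left inner mappings of a loop are bijective. -/
theorem IsLoop.bijective_leftInner_s16 {Q : Type*} {mul : Q → Q → Q} {e : Q} (hQ : IsLoop mul e)
    {ldiv : Q → Q → Q} (hldiv : ∀ x y, mul x (ldiv x y) = y) (x y : Q) :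
    Function.Bijective fun z => ldiv (mul y x) (mul y (mul x z)) := by
  rw [← (hQ.leftBij (mul y x)).of_comp_iff']
  simpa only [Function.comp_def, hldiv] using (hQ.leftBij y).comp (hQ.leftBij x)

/-- The central extension of a loop by an abelian group is a loop. -/
theorem isLoop_qmul {F A : Type*} [AddCommGroup A] {mul : F → F → F} {one : F}
    (hF : IsLoop mul one) {θ : F → F → A} (hθ : ∀ x, θ x one = 0 ∧ θ one x = 0) :
    IsLoop (qmul mul θ) (one, 0) where
  leftBij p := by
    convert ((Equiv.ofBijective _ (hF.leftBij p.1)).prodShear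
      fun y => Equiv.addRight (p.2 + θ p.1 y)).bijective using 1
    ext q <;> simp [qmul]
    abel
  rightBij p := by
    convert ((Equiv.ofBijective _ (hF.rightBij p.1)).prodShear
      fun y => Equiv.addRight (p.2 + θ y p.1)).bijective using 1
    ext q <;> simp [qmul, add_assoc]
  one_mul p := by simp [qmul, hF.one_mul, hθ]
  mul_one p := by simp [qmul, hF.mul_one, hθ]

theorem qmul_comm_iff {F A : Type*} [AddCommGroup A] {mul : F → F → F} {θ : F → F → A} :
    (∀ p q : F × A, qmul mul θ p q = qmul mul θ q p) ↔
      (∀ x y, mul x y = mul y x) ∧ ∀ x y, θ x y = θ y x := by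
  refine ⟨fun h => ⟨fun x y => congrArg Prod.fst (h (x, 0) (y, 0)), fun x y => ?_⟩, ?_⟩
  · simpa [qmul] using congrArg Prod.snd (h (x, 0) (y, 0))
  · rintro ⟨hmul, hθ⟩ p q
    simp only [qmul]
    rw [hmul p.1, hθ p.1, add_comm p.2]

/-- Corollary 5.6: for a loop `F`, an abelian group `A` and a loop cocycle `θ`,
the loop `Q(F,A,θ)` is a commutative automorphic loop if and only if `F` is a
commutative automorphic loop, `θ` is symmetric, and the left automorphic cocycle
identity holds. A commutative loop is automorphic precisely when all left inner
mappings `L_{x,y} = L_{yx}⁻¹ ∘ L_y ∘ L_x` are automorphisms. Here `ldiv` is left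
division in `F`, `qldiv` is left division in `Q(F,A,θ)`, `Lin x y` is the left
inner mapping `L_{x,y}(z) = (yx)\(y(xz))` of `F`, and `QLin p q` is the left
inner mapping of `Q(F,A,θ)`. -/
theorem qmul_commAutomorphic_iff {F A : Type*} [AddCommGroup A]
    (mul : F → F → F) (one : F) (hF : IsLoop mul one)
    (θ : F → F → A) (hθ : ∀ x, θ x one = 0 ∧ θ one x = 0)
    (ldiv : F → F → F) (hldiv : ∀ x y, mul x (ldiv x y) = y)
    (Lin : F → F → F → F)
    (hLin : ∀ x y z, Lin x y z = ldiv (mul y x) (mul y (mul x z)))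
    (qldiv : F × A → F × A → F × A)
    (hqldiv : ∀ p q, qmul mul θ p (qldiv p q) = q)
    (QLin : F × A → F × A → F × A → F × A)
    (hQLin : ∀ p q r, QLin p q r =
      qldiv (qmul mul θ q p) (qmul mul θ q (qmul mul θ p r))) :
    ((∀ p q : F × A, qmul mul θ p q = qmul mul θ q p) ∧
      (∀ p q : F × A, Function.Bijective (QLin p q) ∧
        ∀ r s, QLin p q (qmul mul θ r s) = qmul mul θ (QLin p q r) (QLin p q s))) ↔
      ((∀ x y, mul x y = mul y x) ∧
        (∀ x y : F, Function.Bijective (Lin x y) ∧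
          ∀ z u, Lin x y (mul z u) = mul (Lin x y z) (Lin x y u)) ∧
        (∀ x y, θ x y = θ y x) ∧
        (∀ x y z u : F,
          θ x z + θ x u + θ y (mul x z) + θ y (mul x u) +
            θ (mul y x) (Lin x y (mul z u)) + θ (Lin x y z) (Lin x y u) =
          θ z u + θ y x + θ x (mul z u) + θ y (mul x (mul z u)) +
            θ (mul y x) (Lin x y z) + θ (mul y x) (Lin x y u))) := by
  have hQ := isLoop_qmul hF hθ
  have hLin_mul (x y z) : mul (mul y x) (Lin x y z) = mul y (mul x z) := by
    rw [hLin, hldiv]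
  have bijective_Lin (x y) : Function.Bijective (Lin x y) := by
    rw [funext (hLin x y)]
    exact hF.bijective_leftInner_s16 hldiv x y
  have bijective_QLin (p q) : Function.Bijective (QLin p q) := by
    rw [funext (hQLin p q)]
    exact hQ.bijective_leftInner_s16 hqldiv p q
  have QLin_eq (p q r : F × A) : QLin p q r = (Lin p.1 q.1 r.1,
      r.2 + θ p.1 r.1 + θ q.1 (mul p.1 r.1) - θ q.1 p.1 -
        θ (mul q.1 p.1) (Lin p.1 q.1 r.1)) := by
    rw [hQLin]
    apply hQ.ldiv_eq_of_mul_eq hqldiv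
    simp only [qmul, Prod.mk.injEq]
    exact ⟨hLin_mul _ _ _, by abel⟩
  have QLin_mul_iff (p q r s : F × A) :
      QLin p q (qmul mul θ r s) = qmul mul θ (QLin p q r) (QLin p q s) ↔
      Lin p.1 q.1 (mul r.1 s.1) = mul (Lin p.1 q.1 r.1) (Lin p.1 q.1 s.1) ∧
      θ p.1 r.1 + θ p.1 s.1 + θ q.1 (mul p.1 r.1) + θ q.1 (mul p.1 s.1) +
          θ (mul q.1 p.1) (Lin p.1 q.1 (mul r.1 s.1)) + θ (Lin p.1 q.1 r.1) (Lin p.1 q.1 s.1) =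
        θ r.1 s.1 + θ q.1 p.1 + θ p.1 (mul r.1 s.1) + θ q.1 (mul p.1 (mul r.1 s.1)) +
          θ (mul q.1 p.1) (Lin p.1 q.1 r.1) + θ (mul q.1 p.1) (Lin p.1 q.1 s.1) := by
    simp only [QLin_eq, qmul, Prod.mk.injEq]
    refine and_congr_right fun _ => ?_
    constructor <;> intro h <;> rw [← sub_eq_zero] at h ⊢ <;> rw [← neg_eq_zero, ← h] <;> abel
  rw [qmul_comm_iff]
  constructor
  · rintro ⟨⟨hmul, hsymm⟩, h⟩
    have key x y z u := (QLin_mul_iff (x, 0) (y, 0) (z, 0) (u, 0)).1 ((h _ _).2 _ _)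
    exact ⟨hmul, fun x y => ⟨bijective_Lin x y, fun z u => (key x y z u).1⟩, hsymm,
      fun x y z u => (key x y z u).2⟩
  · rintro ⟨hmul, hauto, hsymm, hcocycle⟩
    exact ⟨⟨hmul, hsymm⟩, fun p q => ⟨bijective_QLin p q, fun r s =>
      (QLin_mul_iff p q r s).2 ⟨(hauto _ _).2 _ _, hcocycle _ _ _ _⟩⟩⟩
end

section
/- Up to isomorphism, there are exactly 7 involutory latin quandles of cardinality 27; equivalently, the set of involutory latin quandle structures on a 27-element set, modulo the equivalence relation identifying two structures when there is a multiplication-preserving bijection between them, has exactly 7 classes. -/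
namespace InvolutoryLatinQuandle

/-! ### Seven models on `{0, …, 26}` -/

/-- The twisted product on `ℤ/9 × ℤ/3`, with `(i, u)` encoded as `9 * u + i`. -/
def twisted (a b c x y : ℕ) : ℕ :=
  let u := x / 9
  let v := y / 9
  let e := x % 9 + 9 - y % 9
  9 * ((2 * u + 3 - v) % 3) +
    (2 * (x % 9) + 9 - y % 9 +
      3 * (u * (a * e * e + b * (u + 3 - v) * e + c * (1 + v * v + u * v)))) % 9

/-- The affine quandle of `(ℤ/3)³` in ternary encoding. -/
def elementary (x y : ℕ) : ℕ :=
  9 * ((2 * (x / 9) + 2 * (y / 9)) % 3) + 3 * ((2 * (x / 3 % 3) + 2 * (y / 3 % 3)) % 3) +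
    (2 * (x % 3) + 2 * (y % 3)) % 3

/-- The seven models. -/
def model : ℕ → ℕ → ℕ → ℕ
  | 0 => elementary
  | 1 => fun x y => (2 * x + 27 - y) % 27
  | 2 => twisted 0 0 0
  | 3 => twisted 1 0 0
  | 4 => twisted 0 1 0
  | 5 => twisted 0 2 0
  | _ => twisted 1 0 2

/-! ### A checker for case analyses on partial multiplication tables

A state is a sequence of numbers below `32`, an entry `27` being unknown. It is packed into a single
natural number, in base `32` and with all entries shifted by the bitwise sum with `27`, so that `0`
is the state in which nothing is known. -/

/-- A forced entry: the last two arguments are its position in the state and its value. -/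
inductive Step
  /-- `x * (y * z)` is read off from `(x * y) * (x * z)`. -/
  | left (x y z i v : ℕ)
  /-- `(x * y) * (x * z)` is read off from `x * (y * z)`. -/
  | right (x y z i v : ℕ)
  /-- `x * (x * y)` is `y`. -/
  | inv (x y i v : ℕ)

/-- A case analysis. -/
inductive Cert
  | steps (s : List Step) (c : Cert)
  /-- Contradiction: `x * y = w * y`. -/
  | col (x w y : ℕ)
  /-- Contradiction: `x * (y * z) ≠ (x * y) * (x * z)`. -/
  | dist (x y z : ℕ)
  /-- Contradiction: `x * (x * y) ≠ y`. -/
  | invol (x y : ℕ)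
  /-- Distinguish the values of the entry `i`. -/
  | split (i : ℕ) (c : Cert)
  | alt (v : ℕ) (c r : Cert)
  | done
  /-- The table is complete and `p`, packed like a state, is an isomorphism onto `model j`. -/
  | iso (j p : ℕ)

/-- The entry of a state at a given position. -/
def entry (N i : ℕ) : ℕ := ((N >>> (5 * i)) &&& 31) ^^^ 27

/-- Replace the entry at a position by a number below `32`. -/
def assign (N i v : ℕ) : ℕ := N ^^^ ((entry N i ^^^ v) <<< (5 * i))

/-- How products are read off from a state, and how a product determines an entry. -/
structure Layout where
  read : ℕ → ℕ → ℕ → ℕ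
  locate : ℕ → ℕ → ℕ → ℕ × ℕ

namespace Layout

/-- Whether the step is justified in the state `L`. -/
def stepOK (lay : Layout) (L : ℕ) : Step → Bool
  | .left x y z i v =>
    let b := lay.read L (lay.read L x y) (lay.read L x z)
    let u := lay.read L y z
    Nat.blt u 27 && (Nat.blt b 27 && (Nat.beq (lay.locate x u b).1 i &&
      Nat.beq (lay.locate x u b).2 v))
  | .right x y z i v =>
    let b := lay.read L x (lay.read L y z)
    let s := lay.read L x y
    let t := lay.read L x z
    Nat.blt s 27 && (Nat.blt t 27 && (Nat.blt b 27 &&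
      (Nat.beq (lay.locate s t b).1 i && Nat.beq (lay.locate s t b).2 v)))
  | .inv x y i v =>
    let b := lay.read L x y
    Nat.blt b 27 && (Nat.beq (lay.locate x b y).1 i && Nat.beq (lay.locate x b y).2 v)

/-- The state after a step. -/
def next (L : ℕ) : Step → ℕ
  | .left _ _ _ i v => assign L i v
  | .right _ _ _ i v => assign L i v
  | .inv _ _ i v => assign L i v

/-- Perform a list of steps, if they are justified. -/
def runSteps (lay : Layout) : List Step → ℕ → Option ℕ
  | [], L => some L
  | s :: r, L => bif lay.stepOK L s then runSteps lay r (next L s) else none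

/-- Whether `p` is an isomorphism from the table read off from `L` onto `model j`: it is onto, and
compatible with the left translations by `0`, `1`, `3` and `9`. -/
def isoOK (lay : Layout) (L : ℕ) (j p : ℕ) : Bool :=
  Nat.blt j 7 && (((List.range 27).all fun x => Nat.blt (entry p x) 27) &&
    (Nat.beq ((List.range 27).foldr (fun x N => N ||| 1 <<< entry p x) 0) (2 ^ 27 - 1) &&
      [0, 1, 3, 9].all fun x => (List.range 27).all fun y =>
        Nat.blt (lay.read L x y) 27 &&
          Nat.beq (entry p (lay.read L x y)) (model j (entry p x) (entry p y))))

/-- Check a case analysis in the state `L`, given that the entry `i` is at least `k`. -/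
def check (lay : Layout) : Cert → ℕ → ℕ → ℕ → Bool
  | .steps s c, L, i, k => match lay.runSteps s L with
    | none => false
    | some M => check lay c M i k
  | .col x w y, L, _, _ => Nat.blt (lay.read L x y) 27 &&
      (!Nat.beq x w && Nat.beq (lay.read L x y) (lay.read L w y))
  | .dist x y z, L, _, _ =>
    let a := lay.read L x (lay.read L y z)
    let b := lay.read L (lay.read L x y) (lay.read L x z)
    Nat.blt a 27 && (Nat.blt b 27 && !Nat.beq a b)
  | .invol x y, L, _, _ =>
    let a := lay.read L x (lay.read L x y)
    Nat.blt a 27 && !Nat.beq a y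
  | .split i c, L, _, _ => check lay c L i 0
  | .alt v c r, L, i, k => Nat.beq v k &&
      (check lay c (assign L i v) 0 0 && check lay r L i (k + 1))
  | .done, _, _, k => Nat.ble 27 k
  | .iso j p, L, _, _ => lay.isoOK L j p

end Layout

/-! ### Tables in which a pair generates a subquandle of order nine -/

/-- The left translation by `k < 9` on three copies of `ℤ/9`. -/
def reflect (k y : ℕ) : ℕ :=
  bif Nat.blt y 9 then (2 * k + 9 - y) % 9
  else bif Nat.blt y 18 then 18 + (2 * k + 18 - y) % 9
  else 9 + (2 * k + 27 - y) % 9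

/-- The product of left translations mapping `9` to `w`. -/
def move (w y : ℕ) : ℕ :=
  bif Nat.blt w 18 then reflect (5 * (w - 9) % 9) (reflect 0 y) else reflect (5 * (w - 18) % 9) y

/-- The inverse of `move w`. -/
def unmove (w y : ℕ) : ℕ :=
  bif Nat.blt w 18 then reflect 0 (reflect (5 * (w - 9) % 9) y) else reflect (5 * (w - 18) % 9) y

/-- The state is the row of `9`. -/
def nineLayout : Layout where
  read L w y :=
    bif Nat.blt w 27 && Nat.blt y 27 then
      bif Nat.blt w 9 then reflect w y
      else bif Nat.blt (entry L (unmove w y)) 27 then move w (entry L (unmove w y)) else 27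
    else 27
  locate w y v := bif Nat.blt w 9 then (9, 9) else (unmove w y, unmove w v)

/-- The initial state: only `9 * 9 = 9` is known. -/
def nineInit : ℕ := assign 0 9 9

/-- The case analysis. -/
def nineCert : Cert :=
  .split 18 (.alt 0 (.steps [.inv 9 18 0 18] (.split 21 (.alt 0 (.invol 9 21) (.alt 1 (.steps
    [.inv 9 21 1 21, .left 9 1 9 20 2] (.col 9 11 20)) (.alt 2 (.steps [.inv 9 21 2 21, .left 9 21
    9 1 22, .right 9 1 2 10 13, .left 9 1 21 17 10] (.invol 9 17)) (.alt 3 (.col 9 15 18) (.alt 4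
    (.steps [.inv 9 21 4 21, .left 9 4 9 26 8] (.col 9 17 26)) (.alt 5 (.steps [.inv 9 21 5 21,
    .left 9 21 9 7 19, .left 9 5 21 16 11, .right 9 7 0 10 16] (.invol 9 10)) (.alt 6 (.steps
    [.inv 9 21 6 21] (.split 3 (.alt 0 (.col 9 6 3) (.alt 1 (.col 9 2 3) (.alt 2 (.col 9 7 3)
    (.alt 3 (.col 9 3 3) (.alt 4 (.col 9 8 3) (.alt 5 (.col 9 4 3) (.alt 6 (.col 9 0 3) (.alt 7
    (.col 9 5 3) (.alt 8 (.col 9 1 3) (.alt 9 (.invol 9 3) (.alt 10 (.steps [.right 9 0 3 26 15]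
    (.col 9 7 26)) (.alt 11 (.steps [.right 9 0 3 25 15] (.col 9 2 25)) (.alt 12 (.col 9 21 0)
    (.alt 13 (.steps [.right 9 0 3 23 15] (.col 9 1 23)) (.alt 14 (.steps [.right 9 0 3 22 15]
    (.col 9 5 22)) (.alt 15 (.col 9 18 3) (.alt 16 (.steps [.right 9 0 3 20 15] (.col 9 4 20))
    (.alt 17 (.steps [.right 9 0 3 19 15] (.col 9 8 19)) (.alt 18 (.col 9 15 3) (.alt 19 (.steps
    [.inv 9 3 19 3, .right 9 6 3 11 12, .left 9 19 9 7 24] (.dist 9 7 11)) (.alt 20 (.steps [.inv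
    9 3 20 3, .left 9 3 9 24 8, .right 9 6 3 10 12, .left 9 20 9 8 24] (.dist 9 8 10)) (.alt 21
    (.col 9 15 0) (.alt 22 (.steps [.inv 9 3 22 3, .right 9 0 3 14 15, .left 9 3 9 24 1, .left 9
    22 9 1 24] (.dist 9 1 14)) (.alt 23 (.steps [.inv 9 3 23 3, .right 9 0 3 13 15, .left 9 23 9 2
    24] (.dist 9 2 13)) (.alt 24 (.steps [.inv 9 3 24 3, .right 9 0 3 12 15, .right 9 0 6 15 12]
    (.split 10 (.alt 0 (.invol 9 10) (.alt 1 (.col 9 19 10) (.alt 2 (.steps [.inv 9 10 2 10,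
    .right 9 2 10 1 5] (.col 9 3 1)) (.alt 3 (.invol 9 10) (.alt 4 (.col 9 25 10) (.alt 5 (.steps
    [.inv 9 10 5 10, .right 9 5 10 4 8] (.col 9 6 4)) (.alt 6 (.invol 9 10) (.alt 7 (.col 9 22 10)
    (.alt 8 (.steps [.inv 9 10 8 10, .right 9 8 10 7 2] (.col 9 0 7)) (.alt 9 (.invol 9 10) (.alt
    10 (.col 9 17 9) (.alt 11 (.steps [.inv 9 10 11 10, .right 9 10 11 17 13, .right 9 10 12 13
    17, .left 9 10 13 16 14, .right 9 11 12 14 16] (.split 1 (.alt 0 (.col 9 5 1) (.alt 1 (.col 9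
    1 1) (.alt 2 (.col 9 6 1) (.alt 3 (.col 9 2 1) (.alt 4 (.col 9 7 1) (.alt 5 (.col 9 3 1) (.alt
    6 (.col 9 8 1) (.alt 7 (.col 9 4 1) (.alt 8 (.col 9 0 1) (.alt 9 (.invol 9 1) (.alt 10 (.col 9
    19 0) (.alt 11 (.invol 9 1) (.alt 12 (.invol 9 1) (.alt 13 (.col 9 25 1) (.alt 14 (.invol 9 1)
    (.alt 15 (.invol 9 1) (.alt 16 (.col 9 22 1) (.alt 17 (.invol 9 1) (.alt 18 (.invol 9 1) (.alt
    19 (.col 9 17 0) (.alt 20 (.steps [.inv 9 1 20 1, .left 9 0 1 8 22, .left 9 0 14 22 8, .left 9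
    1 0 2 19, .left 9 1 6 5 25, .left 9 1 10 19 2, .left 9 1 13 25 5, .left 9 0 2 7 23, .left 9 0
    5 4 26, .left 9 0 10 26 4, .left 9 0 13 23 7] (.iso 3
    15896957574547613986345203067129346064187)) (.alt 21 (.invol 9 1) (.alt 22
    (.col 9 16 1) (.alt 23 (.steps [.inv 9 1 23 1, .left 9 0 1 8 19, .right 9 0 13 19 8, .left 9 1
    0 2 25, .left 9 1 6 5 22, .left 9 1 9 20 4, .right 9 1 11 22 5, .left 9 1 13 25 2, .right 9 1
    23 4 20, .left 9 0 2 7 26, .left 9 0 10 26 7] (.iso 4 4025475765873393825019611918769426541979))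
    (.alt 24 (.invol 9 1) (.alt 25
    (.col 9 13 1) (.alt 26 (.steps [.inv 9 1 26 1, .left 9 0 1 8 25, .right 9 0 10 25 8, .left 9 1
    0 2 22, .left 9 1 6 5 19, .left 9 1 9 20 7, .left 9 1 10 19 5, .left 9 1 16 22 2, .right 9 1
    26 7 20, .left 9 0 5 4 23, .left 9 0 13 23 4] (.iso 3
    28180396361907235253472201939825513660219))
    .done))))))))))))))))))))))))))))) (.alt 12 (.invol 9 10) (.alt 13 (.col 9 16 10) (.alt 14
    (.steps [.inv 9 10 14 10, .right 9 14 10 13 11, .right 9 14 15 11 13, .right 9 10 11 17 16,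
    .left 9 10 13 16 17] (.split 1 (.alt 0 (.col 9 5 1) (.alt 1 (.col 9 1 1) (.alt 2 (.col 9 6 1)
    (.alt 3 (.col 9 2 1) (.alt 4 (.col 9 7 1) (.alt 5 (.col 9 3 1) (.alt 6 (.col 9 8 1) (.alt 7
    (.col 9 4 1) (.alt 8 (.col 9 0 1) (.alt 9 (.invol 9 1) (.alt 10 (.col 9 19 0) (.alt 11 (.invol
    9 1) (.alt 12 (.invol 9 1) (.alt 13 (.col 9 25 1) (.alt 14 (.invol 9 1) (.alt 15 (.invol 9 1)
    (.alt 16 (.col 9 22 1) (.alt 17 (.invol 9 1) (.alt 18 (.invol 9 1) (.alt 19 (.col 9 17 0)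
    (.alt 20 (.steps [.inv 9 1 20 1, .left 9 0 1 8 19, .right 9 0 16 19 8, .left 9 1 0 2 25, .left
    9 1 6 5 22, .right 9 1 11 25 2, .left 9 1 16 22 5, .left 9 0 2 7 23, .left 9 0 5 4 26, .left 9
    0 10 26 4, .right 9 0 11 23 7] (.iso 3 16939727557597601834394253782866085216059)) (.alt 21
    (.invol 9 1) (.alt 22 (.col 9 16 1)
    (.alt 23 (.steps [.inv 9 1 23 1, .left 9 0 1 8 25, .left 9 0 11 25 8, .left 9 1 0 2 22, .left
    9 1 6 5 19, .left 9 1 9 20 4, .left 9 1 10 19 5, .right 9 1 14 22 2, .right 9 1 23 4 20, .left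
    9 0 2 7 26, .left 9 0 10 26 7] (.iso 3 3251625421542785010594412152955806351163)) (.alt 24
    (.invol 9 1) (.alt 25 (.col 9 13 1)
    (.alt 26 (.steps [.inv 9 1 26 1, .left 9 0 1 8 22, .right 9 0 10 22 8, .left 9 1 0 2 19, .left
    9 1 6 5 25, .left 9 1 9 20 7, .left 9 1 10 19 2, .left 9 1 13 25 5, .right 9 1 26 7 20, .left
    9 0 5 4 23, .right 9 0 11 23 4] (.iso 4 35819897744320665817064832692234078662043))
    .done))))))))))))))))))))))))))))) (.alt 15
    (.invol 9 10) (.alt 16 (.col 9 13 10) (.alt 17 (.steps [.inv 9 10 17 10, .left 9 10 9 11 16,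
    .left 9 17 9 16 11, .left 9 10 16 13 14, .left 9 11 17 14 13] (.split 1 (.alt 0 (.col 9 5 1)
    (.alt 1 (.col 9 1 1) (.alt 2 (.col 9 6 1) (.alt 3 (.col 9 2 1) (.alt 4 (.col 9 7 1) (.alt 5
    (.col 9 3 1) (.alt 6 (.col 9 8 1) (.alt 7 (.col 9 4 1) (.alt 8 (.col 9 0 1) (.alt 9 (.invol 9
    1) (.alt 10 (.col 9 19 0) (.alt 11 (.invol 9 1) (.alt 12 (.invol 9 1) (.alt 13 (.col 9 25 1)
    (.alt 14 (.invol 9 1) (.alt 15 (.invol 9 1) (.alt 16 (.col 9 22 1) (.alt 17 (.invol 9 1) (.alt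
    18 (.invol 9 1) (.alt 19 (.col 9 17 0) (.alt 20 (.steps [.inv 9 1 20 1, .left 9 0 1 8 25,
    .left 9 0 11 25 8, .left 9 1 0 2 22, .left 9 1 6 5 19, .left 9 1 10 19 5, .right 9 1 11 22 2,
    .left 9 0 2 7 23, .left 9 0 5 4 26, .left 9 0 10 26 4, .left 9 0 13 23 7] (.iso 5
    3251625421542785010594412152955806351163)) (.alt
    21 (.invol 9 1) (.alt 22 (.col 9 16 1) (.alt 23 (.steps [.inv 9 1 23 1, .left 9 0 1 8 22,
    .right 9 0 13 22 8, .left 9 1 0 2 19, .left 9 1 6 5 25, .left 9 1 9 20 4, .left 9 1 10 19 2,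
    .right 9 1 11 25 5, .right 9 1 23 4 20, .left 9 0 2 7 26, .left 9 0 10 26 7] (.iso 4
    3251625421542785010594412152955806351163))
    (.alt 24 (.invol 9 1) (.alt 25 (.col 9 13 1) (.alt 26 (.steps [.inv 9 1 26 1, .left 9 0 1 8
    19, .right 9 0 10 19 8, .left 9 1 0 2 25, .left 9 1 6 5 22, .left 9 1 9 20 7, .left 9 1 13 25
    2, .right 9 1 14 22 5, .right 9 1 26 7 20, .left 9 0 5 4 23, .left 9 0 13 23 4] (.iso 2
    3251625421542785010594412152955806351163))
    .done))))))))))))))))))))))))))))) (.alt 18 (.col 9 5 10) (.alt 19 (.col 9 1 10) (.alt 20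
    (.col 9 6 10) (.alt 21 (.col 9 2 10) (.alt 22 (.col 9 7 10) (.alt 23 (.col 9 3 10) (.alt 24
    (.col 9 8 10) (.alt 25 (.col 9 4 10) (.alt 26 (.col 9 0 10) .done)))))))))))))))))))))))))))))
    (.alt 25 (.steps [.inv 9 3 25 3, .right 9 0 3 11 15, .left 9 3 9 24 4, .left 9 25 9 4 24]
    (.dist 9 4 11)) (.alt 26 (.steps [.inv 9 3 26 3, .right 9 0 3 10 15, .left 9 26 9 5 24] (.dist
    9 5 10)) .done))))))))))))))))))))))))))))) (.alt 7 (.steps [.inv 9 21 7 21, .left 9 7 9 23 5]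
    (.col 9 14 23)) (.alt 8 (.steps [.inv 9 21 8 21, .left 9 21 9 4 25, .right 9 4 8 13 16, .left
    9 4 21 14 13] (.invol 9 14)) (.alt 9 (.col 9 6 21) (.alt 10 (.col 9 2 21) (.alt 11 (.col 9 7
    21) (.alt 12 (.col 9 3 21) (.alt 13 (.col 9 8 21) (.alt 14 (.col 9 4 21) (.alt 15 (.col 9 0
    21) (.alt 16 (.col 9 5 21) (.alt 17 (.col 9 1 21) (.alt 18 (.invol 9 21) (.alt 19 (.steps
    [.inv 9 21 19 21, .left 9 19 9 16 11, .left 9 21 9 11 16, .left 9 11 9 13 14, .left 9 11 21 23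
    26, .left 9 16 19 26 23] (.dist 9 13 21)) (.alt 20 (.steps [.inv 9 21 20 21, .left 9 20 9 17
    10, .left 9 21 9 10 17, .left 9 17 9 16 11, .left 9 17 20 19 22] (.dist 9 16 19)) (.alt 21
    (.col 9 21 9) (.alt 22 (.steps [.inv 9 21 22 21, .left 9 21 9 17 10, .left 9 22 9 10 17, .left
    9 10 22 23 20, .left 9 17 9 16 11, .left 9 17 21 20 23] (.dist 9 16 21)) (.alt 23 (.steps
    [.inv 9 21 23 21, .left 9 21 9 16 11, .left 9 23 9 11 16, .left 9 11 23 25 19, .left 9 16 21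
    19 25] (.dist 9 11 21)) (.alt 24 (.steps [.inv 9 21 24 21, .left 9 21 9 15 12] (.col 9 18 15))
    (.alt 25 (.steps [.inv 9 21 25 21, .left 9 21 9 14 13, .left 9 25 9 13 14, .left 9 13 25 20
    26, .left 9 14 9 10 17, .left 9 14 21 26 20] (.dist 9 10 21)) (.alt 26 (.steps [.inv 9 21 26
    21, .left 9 21 9 13 14, .left 9 26 9 14 13, .left 9 14 9 10 17, .left 9 14 26 22 25] (.dist 9
    10 22)) .done))))))))))))))))))))))))))))) (.alt 1 (.steps [.inv 9 18 1 18, .left 9 1 9 20 8,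
    .left 9 18 9 8 20, .left 9 1 18 11 16, .left 9 8 9 25 3, .left 9 8 18 16 11, .left 9 20 9 3
    25, .left 9 1 16 22 6, .left 9 3 1 5 23, .left 9 3 9 24 4, .left 9 3 20 13 14, .left 9 8 1 6
    22, .left 9 8 20 14 13, .left 9 16 1 23 5, .left 9 25 9 4 24, .left 9 1 23 15 12, .left 9 3 8
    7 21, .left 9 3 16 26 2, .left 9 3 25 17 10, .right 9 4 5 10 17, .left 9 4 6 2 26, .left 9 4 8
    0 19, .right 9 4 13 19 0, .left 9 4 14 21 7, .left 9 4 23 12 15] (.iso 1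
    11863127976090015572104971214818261655483)) (.alt 2 (.steps
    [.inv 9 18 2 18, .left 9 2 9 22 7, .left 9 18 9 7 22, .left 9 2 18 13 14, .left 9 7 9 23 6,
    .left 9 7 18 14 13, .left 9 22 9 6 23, .left 9 2 14 26 3, .left 9 6 2 1 19, .left 9 6 9 21 8,
    .left 9 6 22 17 10, .left 9 7 2 3 26, .left 9 7 22 10 17, .left 9 14 2 19 1, .left 9 23 9 8
    21, .left 9 1 2 0 20, .right 9 1 3 11 16, .left 9 1 6 5 24, .right 9 1 8 16 11, .left 9 1 9 20
    0, .left 9 1 13 25 4, .left 9 1 26 12 15, .left 9 3 2 4 25, .left 9 3 9 24 5, .left 9 3 18 15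
    12] (.iso 1 14331798136992910703306442028434639347643)) (.alt 3 (.steps [.inv 9 18 3 18, .left 9
    3 9 24 6, .left 9 18 9 6 24,
    .left 9 3 18 15 12, .left 9 6 9 21 0, .left 9 6 18 12 15, .left 9 24 9 0 21] (.split 11 (.alt
    0 (.invol 9 11) (.alt 1 (.steps [.inv 9 11 1 11] (.dist 9 1 18)) (.alt 2 (.col 9 26 11) (.alt
    3 (.invol 9 11) (.alt 4 (.steps [.inv 9 11 4 11] (.dist 9 4 24)) (.alt 5 (.col 9 23 11) (.alt
    6 (.invol 9 11) (.alt 7 (.steps [.inv 9 11 7 11] (.dist 9 7 21)) (.alt 8 (.col 9 20 11) (.alt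
    9 (.invol 9 11) (.alt 10 (.steps [.inv 9 11 10 11, .right 9 10 11 17 13, .right 9 10 12 13 17,
    .left 9 10 13 16 14, .right 9 11 12 14 16] (.split 1 (.alt 0 (.col 9 5 1) (.alt 1 (.col 9 1 1)
    (.alt 2 (.col 9 6 1) (.alt 3 (.col 9 2 1) (.alt 4 (.col 9 7 1) (.alt 5 (.col 9 3 1) (.alt 6
    (.col 9 8 1) (.alt 7 (.col 9 4 1) (.alt 8 (.col 9 0 1) (.alt 9 (.invol 9 1) (.alt 10 (.col 9
    25 1) (.alt 11 (.invol 9 1) (.alt 12 (.invol 9 1) (.alt 13 (.col 9 22 1) (.alt 14 (.invol 9 1)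
    (.alt 15 (.invol 9 1) (.alt 16 (.col 9 19 0) (.alt 17 (.invol 9 1) (.alt 18 (.invol 9 1) (.alt
    19 (.col 9 13 1) (.alt 20 (.steps [.inv 9 1 20 1, .left 9 0 1 8 19, .left 9 0 11 25 2, .right
    9 0 20 2 25, .left 9 1 6 5 22, .left 9 1 10 19 8, .right 9 1 14 22 5, .left 9 0 2 7 23, .left
    9 0 5 4 26, .left 9 0 10 26 4, .left 9 0 13 23 7] (.iso 4
    41702938576158633611961965661030943829403)) (.alt 21 (.invol 9 1) (.alt
    22 (.col 9 17 0) (.alt 23 (.steps [.inv 9 1 23 1, .left 9 0 1 8 25, .right 9 0 13 22 2, .right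
    9 0 23 2 22, .left 9 1 6 5 19, .left 9 1 9 20 4, .left 9 1 10 19 5, .left 9 1 13 25 8, .right
    9 1 23 4 20, .left 9 0 2 7 26, .left 9 0 10 26 7] (.iso 4
    24626126535990776336857652866841183006107)) (.alt 24 (.invol 9 1) (.alt 25
    (.col 9 16 1) (.alt 26 (.steps [.inv 9 1 26 1, .left 9 0 1 8 22, .right 9 0 10 19 2, .right 9
    0 26 2 19, .left 9 1 6 5 25, .left 9 1 9 20 7, .right 9 1 11 25 5, .left 9 1 16 22 8, .right 9
    1 26 7 20, .left 9 0 5 4 23, .left 9 0 13 23 4] (.iso 6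
    29585069760853302069613723529213237985083))
    .done))))))))))))))))))))))))))))) (.alt 11 (.col 9 16 9) (.alt 12 (.invol 9 11) (.alt 13
    (.steps [.inv 9 11 13 11, .right 9 11 13 16 17, .right 9 11 15 17 16, .left 9 11 17 14 10,
    .left 9 12 11 10 14] (.split 1 (.alt 0 (.col 9 5 1) (.alt 1 (.col 9 1 1) (.alt 2 (.col 9 6 1)
    (.alt 3 (.col 9 2 1) (.alt 4 (.col 9 7 1) (.alt 5 (.col 9 3 1) (.alt 6 (.col 9 8 1) (.alt 7
    (.col 9 4 1) (.alt 8 (.col 9 0 1) (.alt 9 (.invol 9 1) (.alt 10 (.col 9 25 1) (.alt 11 (.invol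
    9 1) (.alt 12 (.invol 9 1) (.alt 13 (.col 9 22 1) (.alt 14 (.invol 9 1) (.alt 15 (.invol 9 1)
    (.alt 16 (.col 9 19 0) (.alt 17 (.invol 9 1) (.alt 18 (.invol 9 1) (.alt 19 (.col 9 13 1)
    (.alt 20 (.steps [.inv 9 1 20 1, .left 9 0 1 8 25, .left 9 0 14 22 2, .right 9 0 20 2 22,
    .left 9 1 6 5 19, .left 9 1 10 19 5, .right 9 1 11 25 8, .left 9 0 2 7 23, .left 9 0 5 4 26,
    .left 9 0 10 26 4, .left 9 0 13 23 7] (.iso 3 4656662615600305444198933063555985899323)) (.alt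
    21 (.invol 9 1) (.alt 22 (.col 9
    17 0) (.alt 23 (.steps [.inv 9 1 23 1, .left 9 0 1 8 22, .right 9 0 13 19 2, .right 9 0 23 2
    19, .left 9 1 6 5 25, .left 9 1 9 20 4, .left 9 1 13 25 5, .right 9 1 14 22 8, .right 9 1 23 4
    20, .left 9 0 2 7 26, .left 9 0 10 26 7] (.iso 6 16939727557597601834394253782866085216059))
    (.alt 24 (.invol 9 1) (.alt 25 (.col
    9 16 1) (.alt 26 (.steps [.inv 9 1 26 1, .left 9 0 1 8 19, .right 9 0 10 25 2, .right 9 0 26 2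
    25, .left 9 1 6 5 22, .left 9 1 9 20 7, .left 9 1 10 19 8, .right 9 1 11 22 5, .right 9 1 26 7
    20, .left 9 0 5 4 23, .left 9 0 13 23 4] (.iso 6 3251625421542785010594412152955806351163))
    .done)))))))))))))))))))))))))))))
    (.alt 14 (.col 9 17 11) (.alt 15 (.invol 9 11) (.alt 16 (.steps [.inv 9 11 16 11, .left 9 11 9
    13 14, .left 9 16 9 14 13, .left 9 11 14 17 10, .left 9 12 14 10 17] (.split 1 (.alt 0 (.col 9
    5 1) (.alt 1 (.col 9 1 1) (.alt 2 (.col 9 6 1) (.alt 3 (.col 9 2 1) (.alt 4 (.col 9 7 1) (.alt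
    5 (.col 9 3 1) (.alt 6 (.col 9 8 1) (.alt 7 (.col 9 4 1) (.alt 8 (.col 9 0 1) (.alt 9 (.invol
    9 1) (.alt 10 (.col 9 25 1) (.alt 11 (.invol 9 1) (.alt 12 (.invol 9 1) (.alt 13 (.col 9 22 1)
    (.alt 14 (.invol 9 1) (.alt 15 (.invol 9 1) (.alt 16 (.col 9 19 0) (.alt 17 (.invol 9 1) (.alt
    18 (.invol 9 1) (.alt 19 (.col 9 13 1) (.alt 20 (.steps [.inv 9 1 20 1, .left 9 0 1 8 22,
    .right 9 0 16 19 2, .right 9 0 20 2 19, .left 9 1 6 5 25, .right 9 1 11 22 8, .left 9 1 13 25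
    5, .left 9 0 2 7 23, .left 9 0 5 4 26, .left 9 0 10 26 4, .right 9 0 11 23 7] (.iso 2
    16939727557597601834394253782866085216059))
    (.alt 21 (.invol 9 1) (.alt 22 (.col 9 17 0) (.alt 23 (.steps [.inv 9 1 23 1, .left 9 0 1 8
    19, .left 9 0 11 25 2, .right 9 0 23 2 25, .left 9 1 6 5 22, .left 9 1 9 20 4, .left 9 1 10 19
    8, .left 9 1 16 22 5, .right 9 1 23 4 20, .left 9 0 2 7 26, .left 9 0 10 26 7] (.iso 6
    14162487878544632939611374620410610733179))
    (.alt 24 (.invol 9 1) (.alt 25 (.col 9 16 1) (.alt 26 (.steps [.inv 9 1 26 1, .left 9 0 1 8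
    25, .right 9 0 10 22 2, .right 9 0 26 2 22, .left 9 1 6 5 19, .left 9 1 9 20 7, .left 9 1 10
    19 5, .left 9 1 13 25 8, .right 9 1 26 7 20, .left 9 0 5 4 23, .right 9 0 11 23 4] (.iso 4
    4656662615600305444198933063555985899323)) .done))))))))))))))))))))))))))))) (.alt 17 (.col 9
    14 11) (.alt 18 (.col 9 1 11) (.alt
    19 (.col 9 6 11) (.alt 20 (.col 9 2 11) (.alt 21 (.col 9 7 11) (.alt 22 (.col 9 3 11) (.alt 23
    (.col 9 8 11) (.alt 24 (.col 9 4 11) (.alt 25 (.col 9 0 11) (.alt 26 (.col 9 5 11)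
    .done))))))))))))))))))))))))))))) (.alt 4 (.steps [.inv 9 18 4 18, .left 9 4 9 26 5, .left 9
    18 9 5 26, .left 9 4 18 17 10, .left 9 5 9 19 3, .left 9 5 18 10 17, .left 9 26 9 3 19, .left
    9 3 4 2 20, .left 9 3 9 24 7, .left 9 3 17 25 6, .left 9 3 26 16 11, .left 9 5 4 6 25, .left 9
    5 26 11 16, .left 9 10 4 20 2, .left 9 19 9 7 24, .left 9 2 3 1 21, .left 9 2 4 0 22, .right 9
    2 6 13 14, .right 9 2 7 14 13, .left 9 2 9 22 0, .left 9 2 17 23 8, .left 9 2 25 15 12, .left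
    9 5 16 21 1, .left 9 5 25 12 15, .left 9 6 4 8 23] (.iso 1
    31170951507835134672056908400778435420091)) (.alt 5 (.steps [.inv 9 18 5
    18, .left 9 5 9 19 4, .left 9 18 9 4 19, .left 9 4 9 26 6, .left 9 4 18 17 10, .left 9 5 18 10
    17, .left 9 19 9 6 26, .left 9 4 5 3 20, .left 9 4 19 16 11, .left 9 5 17 20 3, .left 9 6 5 7
    25, .left 9 6 9 21 2, .left 9 6 19 11 16, .left 9 17 5 25 7, .left 9 26 9 2 21, .left 9 2 3 1
    22, .left 9 2 4 0 23, .right 9 2 6 13 14, .right 9 2 7 14 13, .left 9 2 9 22 1, .right 9 2 11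
    23 0, .left 9 2 16 24 8, .left 9 2 25 15 12, .left 9 5 25 12 15, .left 9 6 4 8 24] (.iso 1
    21336493023726746190674920959511746633659)) (.alt 6 (.steps [.inv 9 18 6 18, .left 9 6 9 21 3,
    .left 9 18 9 3 21, .left 9 3 9 24 0,
    .left 9 3 18 15 12, .left 9 6 18 12 15, .left 9 21 9 0 24] (.split 10 (.alt 0 (.invol 9 10)
    (.alt 1 (.col 9 22 10) (.alt 2 (.steps [.inv 9 10 2 10] (.dist 9 2 21)) (.alt 3 (.invol 9 10)
    (.alt 4 (.col 9 19 10) (.alt 5 (.steps [.inv 9 10 5 10] (.dist 9 5 18)) (.alt 6 (.invol 9 10)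
    (.alt 7 (.col 9 25 10) (.alt 8 (.steps [.inv 9 10 8 10] (.dist 9 8 24)) (.alt 9 (.invol 9 10)
    (.alt 10 (.col 9 17 9) (.alt 11 (.steps [.inv 9 10 11 10, .right 9 10 11 17 13, .right 9 10 12
    13 17, .left 9 10 13 16 14, .right 9 11 12 14 16] (.split 1 (.alt 0 (.col 9 5 1) (.alt 1 (.col
    9 1 1) (.alt 2 (.col 9 6 1) (.alt 3 (.col 9 2 1) (.alt 4 (.col 9 7 1) (.alt 5 (.col 9 3 1)
    (.alt 6 (.col 9 8 1) (.alt 7 (.col 9 4 1) (.alt 8 (.col 9 0 1) (.alt 9 (.invol 9 1) (.alt 10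
    (.col 9 22 1) (.alt 11 (.invol 9 1) (.alt 12 (.invol 9 1) (.alt 13 (.col 9 19 0) (.alt 14
    (.invol 9 1) (.alt 15 (.invol 9 1) (.alt 16 (.col 9 25 1) (.alt 17 (.invol 9 1) (.alt 18
    (.invol 9 1) (.alt 19 (.col 9 16 1) (.alt 20 (.steps [.inv 9 1 20 1, .left 9 0 1 8 25, .right
    9 0 16 19 5, .right 9 0 20 5 19, .left 9 1 0 2 22, .left 9 1 13 25 8, .right 9 1 14 22 2,
    .left 9 0 2 7 23, .left 9 0 5 4 26, .left 9 0 10 26 4, .right 9 0 11 23 7] (.iso 3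
    29585069760853302069613723529213237985083))
    (.alt 21 (.invol 9 1) (.alt 22 (.col 9 13 1) (.alt 23 (.steps [.inv 9 1 23 1, .left 9 0 1 8
    22, .left 9 0 11 25 5, .right 9 0 23 5 25, .left 9 1 0 2 19, .left 9 1 9 20 4, .left 9 1 10 19
    2, .right 9 1 11 22 8, .right 9 1 23 4 20, .left 9 0 2 7 26, .left 9 0 10 26 7] (.iso 6
    28180396361907235253472201939825513660219))
    (.alt 24 (.invol 9 1) (.alt 25 (.col 9 17 0) (.alt 26 (.steps [.inv 9 1 26 1, .left 9 0 1 8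
    19, .right 9 0 10 22 5, .right 9 0 26 5 22, .left 9 1 0 2 25, .left 9 1 9 20 7, .left 9 1 10
    19 8, .right 9 1 11 25 2, .right 9 1 26 7 20, .left 9 0 5 4 23, .right 9 0 11 23 4] (.iso 6
    15896957574547613986345203067129346064187)) .done))))))))))))))))))))))))))))) (.alt 12 (.invol
    9 10) (.alt 13 (.col 9 16 10) (.alt
    14 (.steps [.inv 9 10 14 10, .right 9 14 10 13 11, .right 9 14 15 11 13, .right 9 10 11 17 16,
    .left 9 10 13 16 17] (.split 1 (.alt 0 (.col 9 5 1) (.alt 1 (.col 9 1 1) (.alt 2 (.col 9 6 1)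
    (.alt 3 (.col 9 2 1) (.alt 4 (.col 9 7 1) (.alt 5 (.col 9 3 1) (.alt 6 (.col 9 8 1) (.alt 7
    (.col 9 4 1) (.alt 8 (.col 9 0 1) (.alt 9 (.invol 9 1) (.alt 10 (.col 9 22 1) (.alt 11 (.invol
    9 1) (.alt 12 (.invol 9 1) (.alt 13 (.col 9 19 0) (.alt 14 (.invol 9 1) (.alt 15 (.invol 9 1)
    (.alt 16 (.col 9 25 1) (.alt 17 (.invol 9 1) (.alt 18 (.invol 9 1) (.alt 19 (.col 9 16 1)
    (.alt 20 (.steps [.inv 9 1 20 1, .left 9 0 1 8 22, .left 9 0 11 25 5, .right 9 0 20 5 25,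
    .left 9 1 0 2 19, .left 9 1 10 19 2, .left 9 1 16 22 8, .left 9 0 2 7 23, .left 9 0 5 4 26,
    .left 9 0 10 26 4, .left 9 0 13 23 7] (.iso 4 29221096395521839932352808509224620141979)) (.alt
    21 (.invol 9 1) (.alt 22 (.col 9 13
    1) (.alt 23 (.steps [.inv 9 1 23 1, .left 9 0 1 8 19, .right 9 0 13 22 5, .right 9 0 23 5 22,
    .left 9 1 0 2 25, .left 9 1 9 20 4, .left 9 1 10 19 8, .left 9 1 13 25 2, .right 9 1 23 4 20,
    .left 9 0 2 7 26, .left 9 0 10 26 7] (.iso 6 4656662615600305444198933063555985899323)) (.alt 24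
    (.invol 9 1) (.alt 25 (.col 9
    17 0) (.alt 26 (.steps [.inv 9 1 26 1, .left 9 0 1 8 25, .right 9 0 10 19 5, .right 9 0 26 5
    19, .left 9 1 0 2 22, .left 9 1 9 20 7, .right 9 1 11 22 2, .left 9 1 13 25 8, .right 9 1 26 7
    20, .left 9 0 5 4 23, .left 9 0 13 23 4] (.iso 4 5302912914223904093900087031284121742747))
    .done)))))))))))))))))))))))))))))
    (.alt 15 (.invol 9 10) (.alt 16 (.col 9 13 10) (.alt 17 (.steps [.inv 9 10 17 10, .left 9 10 9
    11 16, .left 9 17 9 16 11, .left 9 10 16 13 14, .left 9 11 17 14 13] (.split 1 (.alt 0 (.col 9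
    5 1) (.alt 1 (.col 9 1 1) (.alt 2 (.col 9 6 1) (.alt 3 (.col 9 2 1) (.alt 4 (.col 9 7 1) (.alt
    5 (.col 9 3 1) (.alt 6 (.col 9 8 1) (.alt 7 (.col 9 4 1) (.alt 8 (.col 9 0 1) (.alt 9 (.invol
    9 1) (.alt 10 (.col 9 22 1) (.alt 11 (.invol 9 1) (.alt 12 (.invol 9 1) (.alt 13 (.col 9 19 0)
    (.alt 14 (.invol 9 1) (.alt 15 (.invol 9 1) (.alt 16 (.col 9 25 1) (.alt 17 (.invol 9 1) (.alt
    18 (.invol 9 1) (.alt 19 (.col 9 16 1) (.alt 20 (.steps [.inv 9 1 20 1, .left 9 0 1 8 19,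
    .left 9 0 14 22 5, .right 9 0 20 5 22, .left 9 1 0 2 25, .left 9 1 10 19 8, .left 9 1 13 25 2,
    .left 9 0 2 7 23, .left 9 0 5 4 26, .left 9 0 10 26 4, .left 9 0 13 23 7] (.iso 4
    16939727557597601834394253782866085216059)) (.alt
    21 (.invol 9 1) (.alt 22 (.col 9 13 1) (.alt 23 (.steps [.inv 9 1 23 1, .left 9 0 1 8 25,
    .right 9 0 13 19 5, .right 9 0 23 5 19, .left 9 1 0 2 22, .left 9 1 9 20 4, .right 9 1 11 25
    8, .left 9 1 16 22 2, .right 9 1 23 4 20, .left 9 0 2 7 26, .left 9 0 10 26 7] (.iso 2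
    4656662615600305444198933063555985899323))
    (.alt 24 (.invol 9 1) (.alt 25 (.col 9 17 0) (.alt 26 (.steps [.inv 9 1 26 1, .left 9 0 1 8
    22, .right 9 0 10 25 5, .right 9 0 26 5 25, .left 9 1 0 2 19, .left 9 1 9 20 7, .left 9 1 10
    19 2, .right 9 1 14 22 8, .right 9 1 26 7 20, .left 9 0 5 4 23, .left 9 0 13 23 4] (.iso 6
    15567514363827839973304547576962361348219)) .done))))))))))))))))))))))))))))) (.alt 18 (.col 9
    5 10) (.alt 19 (.col 9 1 10) (.alt
    20 (.col 9 6 10) (.alt 21 (.col 9 2 10) (.alt 22 (.col 9 7 10) (.alt 23 (.col 9 3 10) (.alt 24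
    (.col 9 8 10) (.alt 25 (.col 9 4 10) (.alt 26 (.col 9 0 10) .done)))))))))))))))))))))))))))))
    (.alt 7 (.steps [.inv 9 18 7 18, .left 9 7 9 23 2, .left 9 18 9 2 23, .left 9 2 9 22 3, .left
    9 2 18 13 14, .left 9 7 18 14 13, .left 9 23 9 3 22, .left 9 2 7 6 19, .left 9 2 23 17 10,
    .left 9 3 7 8 26, .left 9 3 9 24 1, .left 9 3 14 19 6, .left 9 3 23 10 17, .left 9 13 7 26 8,
    .left 9 22 9 1 24, .left 9 1 2 0 25, .right 9 1 3 11 16, .left 9 1 6 5 20, .right 9 1 8 16 11,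
    .left 9 1 9 20 5, .right 9 1 10 25 0, .left 9 1 17 21 4, .left 9 1 26 12 15, .left 9 3 2 4 21,
    .left 9 3 18 15 12] (.iso 1 15736824632407428982704437002512968769467)) (.alt 8 (.steps [.inv 9
    18 8 18, .left 9 8 9 25 1, .left 9
    18 9 1 25, .left 9 1 9 20 6, .left 9 1 18 11 16, .left 9 8 18 16 11, .left 9 25 9 6 20, .left
    9 1 8 3 23, .left 9 1 25 13 14, .left 9 6 8 4 22, .left 9 6 9 21 5, .left 9 6 16 23 3, .left 9
    6 25 14 13, .left 9 11 8 22 4, .left 9 20 9 5 21, .left 9 1 14 24 2, .left 9 1 23 15 12, .left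
    9 3 8 7 19, .left 9 3 16 26 0, .left 9 3 25 17 10, .right 9 4 5 10 17, .left 9 4 6 2 24, .left
    9 4 8 0 26, .left 9 4 16 19 7, .left 9 4 23 12 15] (.iso 1
    29425632271057078843641936014841430204347)) (.alt 9 (.col 9 0 18) (.alt
    10 (.col 9 5 18) (.alt 11 (.col 9 1 18) (.alt 12 (.col 9 6 18) (.alt 13 (.col 9 2 18) (.alt 14
    (.col 9 7 18) (.alt 15 (.col 9 3 18) (.alt 16 (.col 9 8 18) (.alt 17 (.col 9 4 18) (.alt 18
    (.col 9 18 9) (.alt 19 (.steps [.inv 9 18 19 18, .left 9 18 9 17 10, .left 9 19 9 10 17, .left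
    9 10 9 11 16, .left 9 10 19 20 26, .left 9 17 9 16 11, .left 9 10 17 12 15] (.col 9 23 12))
    (.alt 20 (.steps [.inv 9 18 20 18, .left 9 18 9 16 11, .left 9 20 9 11 16, .left 9 11 9 13 14,
    .left 9 11 20 22 25, .left 9 16 9 14 13, .left 9 11 16 15 12] (.col 9 19 15)) (.alt 21 (.steps
    [.inv 9 18 21 18, .left 9 18 9 15 12] (.col 9 24 15)) (.alt 22 (.steps [.inv 9 18 22 18, .left
    9 18 9 14 13, .left 9 22 9 13 14, .left 9 13 9 17 10, .left 9 14 9 10 17, .left 9 10 9 11 16]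
    (.col 9 20 11)) (.alt 23 (.steps [.inv 9 18 23 18, .left 9 18 9 13 14, .left 9 23 9 14 13,
    .left 9 13 9 17 10, .left 9 14 9 10 17, .left 9 10 9 11 16] (.col 9 25 11)) (.alt 24 (.steps
    [.inv 9 18 24 18, .left 9 18 9 12 15] (.col 9 21 12)) (.alt 25 (.steps [.inv 9 18 25 18, .left
    9 18 9 11 16, .left 9 25 9 16 11, .left 9 11 9 13 14, .left 9 11 18 20 23, .left 9 16 9 14 13,
    .left 9 11 16 15 12] (.col 9 26 15)) (.alt 26 (.steps [.inv 9 18 26 18, .left 9 18 9 10 17,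
    .left 9 26 9 17 10, .left 9 10 9 11 16, .left 9 10 18 19 25, .left 9 17 9 16 11, .left 9 10 17
    12 15] (.col 9 22 12)) .done)))))))))))))))))))))))))))

theorem check_nineCert : nineLayout.check nineCert nineInit 0 0 = true := by
  decide +kernel

/-! ### Commutative tables -/

/-- The position of `x * y` in the state. -/
def cell (x y : ℕ) : ℕ := bif Nat.ble x y then 27 * x + y else 27 * y + x

/-- The state is the upper half of the table. -/
def commLayout : Layout where
  read L w y := bif Nat.blt w 27 && Nat.blt y 27 then entry L (cell w y) else 27
  locate w y v := (cell w y, v)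

/-- The product, for `x ≤ y`, in the affine plane over `ℤ/3`. -/
def plane (x y : ℕ) : ℕ :=
  if y < 3 then (2 * x + 2 * y) % 3
  else if x < 3 then if y < 6 then 6 + (y + 2 * x) % 3 else 3 + (y + x) % 3
  else if x < 6 then if y < 6 then 3 + (2 * x + 2 * y) % 3 else (x + 2 * y) % 3
  else 6 + (2 * x + 2 * y) % 3

/-- The products, for `x ≤ y`, which are known from the choice of labels. -/
def commKnown (x y : ℕ) : ℕ :=
  if x = y then x
  else if y < 9 then plane x y
  else if y = 18 ∧ x < 9 then 9 + x
  else if y = 18 ∧ x < 18 then x - 9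
  else if x = 0 ∧ y < 18 then 9 + y
  else if x = 0 then y - 9
  else if y = 9 + x ∧ x < 9 then 18
  else 27

/-- The initial state. -/
def commInit : ℕ := (List.range 729).foldr (fun i N =>
  bif Nat.ble (i / 27) (i % 27) && Nat.blt (commKnown (i / 27) (i % 27)) 27 then
    assign N i (commKnown (i / 27) (i % 27)) else N) 0

/-- The case analysis. -/
def commCert : Cert :=
  .steps [.inv 10 0 289 0, .inv 11 0 317 0, .inv 12 0 345 0, .inv 13 0 373 0, .inv 14 0 401 0,
    .inv 15 0 429 0, .inv 16 0 457 0, .inv 17 0 485 0, .right 0 1 10 73 9, .right 0 1 18 63 19,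
    .right 0 2 11 47 9, .right 0 2 18 36 20, .right 0 3 12 183 9, .right 0 3 18 171 21, .right 0 4
    13 211 9, .right 0 4 18 198 22, .right 0 5 14 239 9, .right 0 5 18 225 23, .right 0 6 15 105
    9, .right 0 6 18 90 24, .right 0 7 16 133 9, .right 0 7 18 117 25, .right 0 8 17 161 9, .right
    0 8 18 144 26, .right 0 10 18 262 2, .right 0 11 18 263 1, .right 0 12 18 264 6, .right 0 13
    18 265 7, .right 0 14 18 266 8, .right 0 15 18 267 3, .right 0 16 18 268 4, .right 0 17 18 269
    5, .right 1 0 9 74 10, .left 1 0 10 46 11, .right 1 0 18 64 20, .left 1 0 20 38 19, .right 1 9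
    18 290 2, .right 2 9 18 316 1, .right 3 0 9 186 12, .left 3 0 12 102 15, .right 3 0 18 174 24,
    .left 3 0 24 96 21, .right 3 9 18 348 6, .right 4 0 9 214 13, .left 4 0 13 130 16, .right 4 0
    18 202 25, .left 4 0 25 124 22, .right 4 9 18 376 7, .right 5 0 9 242 14, .left 5 0 14 158 17,
    .right 5 0 18 230 26, .left 5 0 26 152 23, .right 5 9 18 404 8, .right 6 9 18 426 3, .right 7
    9 18 454 4, .right 8 9 18 482 5, .right 9 0 1 506 19, .right 9 0 2 505 20, .right 9 0 3 510
    21, .right 9 0 4 511 22, .right 9 0 5 512 23, .right 9 0 6 507 24, .right 9 0 7 508 25, .right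
    9 0 8 509 26, .left 9 0 19 253 11, .left 9 0 20 254 10, .left 9 0 21 255 15, .left 9 0 22 256
    16, .left 9 0 23 257 17, .left 9 0 24 258 12, .left 9 0 25 259 13, .left 9 0 26 260 14, .right
    9 1 2 533 18, .right 9 1 3 564 23, .right 9 1 4 565 21, .right 9 1 5 566 22, .right 9 1 6 561
    25, .right 9 1 7 562 26, .right 9 1 8 563 24, .right 9 2 3 537 22, .right 9 2 4 538 23, .right
    9 2 5 539 21, .right 9 2 6 534 26, .right 9 2 7 535 24, .right 9 2 8 536 25, .right 9 3 4 673
    26, .right 9 3 5 674 25, .right 9 3 6 591 18, .right 9 3 7 618 19, .right 9 3 8 645 20, .right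
    9 4 5 701 24, .right 9 4 6 592 20, .right 9 4 7 619 18, .right 9 4 8 646 19, .right 9 5 6 593
    19, .right 9 5 7 620 20, .right 9 5 8 647 18, .right 9 6 7 589 23, .right 9 6 8 590 22, .right
    9 7 8 617 21, .left 10 0 20 281 9, .left 12 0 24 339 9, .left 13 0 25 367 9, .left 14 0 26 395
    9, .right 18 1 3 282 17, .right 18 1 4 283 15, .right 18 1 5 284 16, .right 18 1 6 285 13,
    .right 18 1 7 286 14, .right 18 1 8 287 12, .right 18 2 3 309 16, .right 18 2 4 310 17, .right
    18 2 5 311 15, .right 18 2 6 312 14, .right 18 2 7 313 12, .right 18 2 8 314 13, .right 18 3 4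
    337 14, .right 18 3 5 338 13, .right 18 3 7 340 11, .right 18 3 8 341 10, .right 18 4 5 365
    12, .right 18 4 6 366 10, .right 18 4 8 368 11, .right 18 5 6 393 11, .right 18 5 7 394 10,
    .right 18 6 7 421 17, .right 18 6 8 422 16, .right 18 7 8 449 15] (.split 39 (.alt 0 (.col 2
    12 1) (.alt 1 (.col 1 12 1) (.alt 2 (.col 0 12 1) (.alt 3 (.col 8 12 1) (.alt 4 (.col 6 12 1)
    (.alt 5 (.col 7 12 1) (.alt 6 (.col 4 12 1) (.alt 7 (.col 5 12 1) (.alt 8 (.col 3 12 1) (.alt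
    9 (.col 1 15 12) (.alt 10 (.col 1 17 12) (.alt 11 (.col 1 16 12) (.alt 12 (.col 1 12 12) (.alt
    13 (.col 1 14 12) (.alt 14 (.col 1 13 12) (.alt 15 (.col 1 9 12) (.alt 16 (.col 1 11 12) (.alt
    17 (.col 1 10 12) (.alt 18 (.col 10 12 1) (.alt 19 (.col 11 12 1) (.alt 20 (.col 9 12 1) (.alt
    21 (.col 0 1 12) (.alt 22 (.steps [.inv 1 12 49 12, .inv 12 1 346 1, .right 0 1 12 75 13,
    .right 0 1 22 67 21, .right 0 12 22 372 2, .right 1 3 12 238 10, .right 1 3 18 226 22, .left 1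
    4 22 43 24, .left 1 6 12 51 16, .right 1 7 9 155 12, .right 1 7 16 159 10, .right 1 7 18 145
    24, .right 1 7 22 147 20, .right 1 9 3 236 16, .left 1 9 12 42 26, .left 1 9 16 40 23, .right
    1 9 22 344 5, .right 1 9 24 452 8, .left 1 10 12 44 25, .left 1 10 16 41 21, .right 1 12 18
    292 8, .right 1 13 0 77 12, .left 1 13 2 48 14, .right 1 13 4 185 10, .left 1 13 7 52 17,
    .right 1 13 18 293 6, .right 1 13 22 347 2, .left 1 14 0 50 13, .right 1 14 5 210 10, .left 1
    14 8 53 15, .right 1 14 18 291 7, .right 1 15 0 80 16, .right 1 15 6 134 10, .right 1 15 18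
    296 4, .right 1 15 24 458 2, .right 1 16 0 78 17, .right 1 16 18 294 5, .right 1 16 25 483 2,
    .right 1 17 0 79 15, .right 1 17 8 106 10, .right 1 17 18 295 3, .right 1 17 26 430 2, .right
    1 18 4 172 23, .right 1 18 5 199 21, .right 1 18 6 118 26, .right 1 18 8 91 25, .right 1 21 0
    68 22, .right 1 21 6 122 20, .right 1 21 9 398 4, .right 1 21 12 400 2, .right 1 22 0 66 23,
    .right 1 23 8 94 20, .right 1 23 9 371 3, .right 1 24 0 70 26, .right 1 24 3 232 20, .right 1
    25 0 71 24, .right 1 25 4 179 20, .right 1 25 9 479 6, .right 1 26 0 69 25, .right 1 26 5 204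
    20, .right 1 26 9 425 7, .left 2 0 13 76 14, .right 2 3 9 208 17, .right 2 3 10 209 15, .right
    2 3 12 212 11, .right 2 3 18 200 23, .right 2 3 24 206 19, .right 2 4 9 235 15, .right 2 4 13
    237 11, .right 2 4 18 227 21, .right 2 4 25 231 19, .right 2 5 9 181 16, .right 2 5 10 182 17,
    .right 2 5 14 184 11, .right 2 5 18 173 22, .right 2 5 26 178 19, .right 2 6 9 154 13, .right
    2 6 15 160 11, .right 2 6 18 146 25, .right 2 6 21 148 19, .right 2 7 9 100 14, .right 2 7 10
    101 13, .right 2 7 16 107 11, .right 2 7 18 92 26, .right 2 7 22 95 19, .right 2 8 9 127 12,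
    .right 2 8 10 128 14, .right 2 8 17 132 11, .right 2 8 18 119 24, .right 2 8 23 120 19, .right
    2 9 21 370 5, .right 2 9 22 397 3, .right 2 9 23 343 4, .right 2 9 24 478 7, .right 2 9 25 424
    8, .right 2 9 26 451 6, .right 2 12 18 320 7, .right 2 12 21 374 1, .right 2 13 18 318 8,
    .right 2 13 22 399 1, .right 2 14 18 319 6, .right 2 15 18 322 5, .right 2 15 24 484 1, .right
    2 16 18 323 3, .right 2 16 25 431 1, .right 2 17 18 321 4, .right 2 17 26 456 1, .right 3 0 10
    187 14, .right 3 0 11 188 13, .left 3 0 13 103 17, .left 3 0 14 104 16, .right 3 0 19 176 25,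
    .right 3 0 20 175 26, .left 3 0 25 97 23, .left 3 0 26 98 22, .right 3 1 9 240 13, .right 3 1
    10 241 12, .right 3 1 18 228 25, .right 3 1 20 229 24, .right 3 2 9 213 14, .right 3 2 11 215
    12, .right 3 2 18 201 26, .right 3 2 19 203 24, .right 3 9 19 402 7, .right 3 9 20 375 8,
    .right 3 10 18 349 8, .right 3 10 19 403 6, .right 3 11 18 350 7, .right 3 11 20 377 6, .left
    4 0 12 129 17, .left 4 0 14 131 15, .left 4 0 24 123 23, .left 4 0 26 125 21, .right 4 3 16
    157 15, .right 4 3 17 156 16, .right 4 3 22 151 21, .right 4 3 23 150 22, .right 6 9 19 453 5,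
    .right 6 9 20 480 4, .right 6 10 18 428 4, .right 6 10 19 455 3, .right 6 11 18 427 5, .right
    6 11 20 481 3] (.iso 0 14106709549044628304883749277801021990747)) (.alt 23 (.dist 1 3 12) (.alt
    24 (.col 1 6 12) (.alt 25 (.steps
    [.inv 1 12 52 12, .right 1 4 9 182 12] (.col 20 24 6)) (.alt 26 (.dist 1 3 12)
    .done))))))))))))))))))))))))))))

theorem check_commCert : commLayout.check commCert commInit 0 0 = true := by
  decide +kernel

theorem entry_assign {N i v : ℕ} (hv : v < 32) (k : ℕ) :
    entry (assign N i v) k = if k = i then v else entry N k := by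
  refine Nat.eq_of_testBit_eq fun b => ?_
  have h31 (b : ℕ) : Nat.testBit 31 b = decide (b < 5) := Nat.testBit_two_pow_sub_one 5 b
  have h27 (b : ℕ) (hb : ¬ b < 5) : Nat.testBit 27 b = false :=
    Nat.testBit_lt_two_pow (lt_of_lt_of_le (by norm_num : 27 < 2 ^ 5)
      (Nat.pow_le_pow_right two_pos (not_lt.1 hb)))
  have hvb (b : ℕ) (hb : ¬ b < 5) : Nat.testBit v b = false :=
    Nat.testBit_lt_two_pow (lt_of_lt_of_le (by simpa using hv : v < 2 ^ 5)
      (Nat.pow_le_pow_right two_pos (not_lt.1 hb)))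
  by_cases hb : b < 5
  · split_ifs with hki
    · subst hki
      simp only [entry, assign, Nat.testBit_xor, Nat.testBit_and, Nat.testBit_shiftRight,
        Nat.testBit_shiftLeft, h31, hb, ge_iff_le, Nat.le_add_right, Nat.add_sub_cancel_left,
        decide_true, Bool.and_true, Bool.true_and]
      cases Nat.testBit 27 b <;> cases N.testBit (5 * k + b) <;> simp
    · rcases lt_or_gt_of_ne hki with h | h
      · have : ¬ 5 * i ≤ 5 * k + b := by omega
        simp [entry, assign, h31, hb, this]
      · have h1 : 5 * i ≤ 5 * k + b := by omega
        have h2 : ¬ 5 * k + b - 5 * i < 5 := by omega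
        simp [entry, assign, h31, hb, h27 _ h2, hvb _ h2, h1, h2]
  · split_ifs with hki <;> simp [entry, h31, hb, hvb, h27]

theorem entry_zero (k : ℕ) : entry 0 k = 27 := by
  simp [entry]

/-- A multiplication on `{0, …, 26}`, extended to the natural numbers, satisfying the laws of an
involutory latin quandle. -/
structure IsTable (F : ℕ → ℕ → ℕ) : Prop where
  lt : ∀ x y, F x y < 27
  idem : ∀ x < 27, F x x = x
  distrib : ∀ x y z, F x (F y z) = F (F x y) (F x z)
  invol : ∀ x, ∀ y < 27, F x (F x y) = y
  cancel : ∀ x < 27, ∀ w < 27, ∀ y, F x y = F w y → x = w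

/-- The known entries of the state `L` agree with `u`. -/
def Known (u : ℕ → ℕ) (L : ℕ) : Prop := ∀ i, entry L i < 27 → entry L i = u i

theorem known_zero (u : ℕ → ℕ) : Known u 0 := fun i hi => by simp [entry_zero] at hi

theorem Known.assign {u : ℕ → ℕ} {L i v : ℕ} (h : Known u L) (hv : v < 27) (hi : u i = v) :
    Known u (assign L i v) := fun k hk => by
  rw [entry_assign (by omega)] at hk ⊢
  split_ifs with hki
  · rw [hki, hi]
  · rw [if_neg hki] at hk
    exact h k hk

/-- `φ` is an isomorphism from the table `F` onto the table `G`. -/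
structure IsTableIso (F G : ℕ → ℕ → ℕ) (φ : ℕ → ℕ) : Prop where
  lt : ∀ x < 27, φ x < 27
  surj : ∀ y < 27, ∃ x < 27, φ x = y
  map : ∀ x < 27, ∀ y < 27, φ (F x y) = G (φ x) (φ y)

/-- Left translations of the models by products are conjugates. -/
def ModelConj : Prop :=
  ∀ j < 7, ∀ x < 27, ∀ y < 27, ∀ z < 27,
    model j (model j x y) z = model j x (model j y (model j x z))

namespace Layout

/-- The table `F` with state `u` is correctly described by a layout. -/
structure Sound (lay : Layout) (F : ℕ → ℕ → ℕ) (u : ℕ → ℕ) : Prop where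
  lt : ∀ i, u i < 27
  read : ∀ {L}, Known u L → ∀ {w y}, lay.read L w y < 27 →
    w < 27 ∧ y < 27 ∧ lay.read L w y = F w y
  locate : ∀ {w y}, w < 27 → y < 27 → u (lay.locate w y (F w y)).1 = (lay.locate w y (F w y)).2
  generate : ∀ S : ℕ → Prop, S 0 → S 1 → S 3 → S 9 →
    (∀ x < 27, ∀ y < 27, S x → S y → S (F x y)) → ∀ x < 27, S x

variable {lay : Layout} {F : ℕ → ℕ → ℕ} {u : ℕ → ℕ}

theorem Sound.known_next (hs : lay.Sound F u) (hF : IsTable F) {L : ℕ} (hL : Known u L) {s : Step}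
    (h : lay.stepOK L s = true) : Known u (next L s) := by
  have key {w y : ℕ} (hw : w < 27) (hy : y < 27) {i v : ℕ} (hi : (lay.locate w y (F w y)).1 = i)
      (hv : (lay.locate w y (F w y)).2 = v) : Known u (InvolutoryLatinQuandle.assign L i v) := by
    have := hs.locate hw hy
    rw [hi, hv] at this
    exact hL.assign (this ▸ hs.lt i) this
  cases s with
  | left x y z i v =>
    simp only [stepOK, Nat.blt_eq, Nat.beq_eq, Bool.and_eq_true] at h
    obtain ⟨h1, h2, h3, h4⟩ := h
    obtain ⟨hy, hz, e1⟩ := hs.read hL h1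
    obtain ⟨h5, h6, e2⟩ := hs.read hL h2
    obtain ⟨hx, -, e3⟩ := hs.read hL h5
    obtain ⟨-, -, e4⟩ := hs.read hL h6
    rw [e3, e4] at e2 h3 h4
    rw [e2, ← hF.distrib, ← e1] at h3 h4
    exact key hx h1 h3 h4
  | right x y z i v =>
    simp only [stepOK, Nat.blt_eq, Nat.beq_eq, Bool.and_eq_true] at h
    obtain ⟨h1, h2, h3, h4, h5⟩ := h
    obtain ⟨hx, hy, e1⟩ := hs.read hL h1
    obtain ⟨-, hz, e2⟩ := hs.read hL h2
    obtain ⟨-, h6, e3⟩ := hs.read hL h3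
    obtain ⟨-, -, e4⟩ := hs.read hL h6
    rw [e4] at e3 h4 h5
    rw [e3, hF.distrib, ← e1, ← e2] at h4 h5
    exact key h1 h2 h4 h5
  | inv x y i v =>
    simp only [stepOK, Nat.blt_eq, Nat.beq_eq, Bool.and_eq_true] at h
    obtain ⟨h1, h2, h3⟩ := h
    obtain ⟨hx, hy, e1⟩ := hs.read hL h1
    have e2 : y = F x (lay.read L x y) := by rw [e1, hF.invol x y hy]
    refine key hx h1 ?_ ?_
    · rwa [← e2]
    · rwa [← e2]

theorem Sound.known_runSteps (hs : lay.Sound F u) (hF : IsTable F) (s : List Step) {L M : ℕ}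
    (hL : Known u L) (h : lay.runSteps s L = some M) : Known u M := by
  induction s generalizing L with
  | nil => simpa [runSteps] using (by simpa [runSteps] using h : L = M) ▸ hL
  | cons a r ih =>
    cases ha : lay.stepOK L a with
    | false => simp [runSteps, ha] at h
    | true =>
      simp only [runSteps, ha, cond_true] at h
      exact ih (hs.known_next hF hL ha) h

theorem Sound.isTableIso (hs : lay.Sound F u) (hF : IsTable F) (hM : ModelConj)
    {L j p : ℕ} (hL : Known u L) (h : lay.isoOK L j p = true) :
    j < 7 ∧ IsTableIso F (model j) (entry p) := by
  simp only [isoOK, Nat.blt_eq, Nat.beq_eq, Bool.and_eq_true, List.all_eq_true, List.mem_range]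
    at h
  obtain ⟨hj, hlt, hsurj, hmap⟩ := h
  refine ⟨hj, hlt, fun y hy => ?_, ?_⟩
  · have mem (l : List ℕ)
        (hl : (l.foldr (fun x N => N ||| 1 <<< entry p x) 0).testBit y = true) :
        ∃ x ∈ l, entry p x = y := by
      induction l with
      | nil => simp at hl
      | cons a l ih =>
        rw [List.foldr_cons, Nat.testBit_or, Bool.or_eq_true] at hl
        rcases hl with hl | hl
        · obtain ⟨x, hx, e⟩ := ih hl
          exact ⟨x, List.mem_cons_of_mem _ hx, e⟩
        · rw [Nat.one_shiftLeft, Nat.testBit_two_pow] at hl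
          exact ⟨a, List.mem_cons_self, by simpa using hl⟩
    obtain ⟨x, hx, e⟩ := mem (List.range 27) (by
      rw [hsurj, Nat.testBit_two_pow_sub_one]
      simpa using hy)
    exact ⟨x, List.mem_range.1 hx, e⟩
  · have base (x : ℕ) (hx : x ∈ [0, 1, 3, 9]) (y : ℕ) (hy : y < 27) :
        entry p (F x y) = model j (entry p x) (entry p y) := by
      obtain ⟨h1, h2⟩ := hmap x hx y hy
      rw [← h2, (hs.read hL h1).2.2]
    have conj (x y : ℕ) {z : ℕ} (hz : z < 27) : F (F x y) z = F x (F y (F x z)) := by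
      conv_lhs => rw [← hF.invol x z hz]
      rw [hF.distrib x y]
    refine hs.generate _ (base 0 (by simp)) (base 1 (by simp)) (base 3 (by simp))
      (base 9 (by simp)) fun x hx y hy ex ey z hz => ?_
    rw [conj x y hz, ex _ (hF.lt _ _), ey _ (hF.lt _ _), ex z hz, ex y hy,
      hM j hj _ (hlt x hx) _ (hlt y hy) _ (hlt z hz)]

theorem Sound.check (hs : lay.Sound F u) (hF : IsTable F) (hM : ModelConj)
    (c : Cert) {L i k : ℕ} (hL : Known u L) (hk : k ≤ u i) (h : lay.check c L i k = true) :
    ∃ j < 7, ∃ φ, IsTableIso F (model j) φ := by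
  induction c generalizing L i k with
  | steps s c ih =>
    rw [Layout.check] at h
    split at h
    · simp at h
    · exact ih (hs.known_runSteps hF s hL ‹_›) hk h
  | col x w y =>
    simp only [Layout.check, Nat.blt_eq, Nat.beq_eq, Bool.and_eq_true, Bool.not_eq_true',
      ← Bool.not_eq_true] at h
    obtain ⟨h1, h2, h3⟩ := h
    obtain ⟨hx, hy, e1⟩ := hs.read hL h1
    obtain ⟨hw, -, e2⟩ := hs.read hL (h3 ▸ h1)
    exact absurd (hF.cancel x hx w hw y (by rw [← e1, ← e2, h3])) h2
  | dist x y z =>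
    simp only [Layout.check, Nat.blt_eq, Nat.beq_eq, Bool.and_eq_true, Bool.not_eq_true',
      ← Bool.not_eq_true] at h
    obtain ⟨h1, h2, h3⟩ := h
    obtain ⟨hx, h4, e1⟩ := hs.read hL h1
    obtain ⟨-, -, e2⟩ := hs.read hL h4
    obtain ⟨h5, h6, e3⟩ := hs.read hL h2
    obtain ⟨-, -, e4⟩ := hs.read hL h5
    obtain ⟨-, -, e5⟩ := hs.read hL h6
    rw [e1, e3, e2, e4, e5] at h3
    exact absurd (hF.distrib x y z) h3
  | invol x y =>
    simp only [Layout.check, Nat.blt_eq, Nat.beq_eq, Bool.and_eq_true, Bool.not_eq_true',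
      ← Bool.not_eq_true] at h
    obtain ⟨h1, h2⟩ := h
    obtain ⟨hx, h3, e1⟩ := hs.read hL h1
    obtain ⟨-, hy, e2⟩ := hs.read hL h3
    rw [e1, e2] at h2
    exact absurd (hF.invol x y hy) h2
  | split i c ih => exact ih hL (Nat.zero_le _) h
  | alt v c r ihc ihr =>
    simp only [Layout.check, Nat.beq_eq, Bool.and_eq_true] at h
    obtain ⟨rfl, hc, hr⟩ := h
    rcases hk.eq_or_lt with e | e
    · exact ihc (hL.assign (e ▸ hs.lt i) e.symm) (Nat.zero_le _) hc
    · exact ihr hL e hr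
  | done =>
    simp only [Layout.check, Nat.ble_eq] at h
    exact absurd (hs.lt i) (by omega)
  | iso j p =>
    obtain ⟨hj, hp⟩ := hs.isTableIso hF hM hL h
    exact ⟨j, hj, _, hp⟩

end Layout

theorem blt_eq_decide (a b : ℕ) : Nat.blt a b = decide (a < b) := by
  rw [Bool.eq_iff_iff, Nat.blt_eq, decide_eq_true_iff]

section
variable {F : ℕ → ℕ → ℕ}

theorem nineLayout_sound (hF : IsTable F) (hr : ∀ k < 9, ∀ y < 27, F k y = reflect k y) :
    nineLayout.Sound F (F 9) := by
  have small : ∀ w < 27, 9 ≤ w → 5 * (w - 9) % 9 < 9 ∧ 5 * (w - 18) % 9 < 9 := by omega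
  have reflect_lt : ∀ k < 9, ∀ y < 27, reflect k y < 27 := by decide +kernel
  have unmove_lt : ∀ w < 27, 9 ≤ w → ∀ y < 27, unmove w y < 27 := by decide +kernel
  have move_unmove : ∀ w < 27, 9 ≤ w → ∀ y < 27, move w (unmove w y) = y := by decide +kernel
  have unmove_move : ∀ w < 27, 9 ≤ w → ∀ y < 27, unmove w (move w y) = y := by decide +kernel
  have move_nine : ∀ w < 27, 9 ≤ w → move w 9 = w := by decide +kernel
  have move_eq {w : ℕ} (hw : w < 27) (hw' : 9 ≤ w) : ∃ a < 9, (∀ y < 27, move w y = F a y) ∨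
      ∀ y < 27, move w y = F a (F 0 y) := by
    obtain ⟨h1, h2⟩ := small w hw hw'
    cases h : Nat.blt w 18 with
    | true =>
      refine ⟨_, h1, Or.inr fun y hy => ?_⟩
      rw [move, h, cond_true, hr 0 (by norm_num) y hy,
        hr _ h1 _ (reflect_lt 0 (by norm_num) y hy)]
    | false =>
      refine ⟨_, h2, Or.inl fun y hy => ?_⟩
      rw [move, h, cond_false, hr _ h2 y hy]
  have move_map {w x y : ℕ} (hw : w < 27) (hw' : 9 ≤ w) (hx : x < 27) (hy : y < 27) :
      move w (F x y) = F (move w x) (move w y) := by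
    obtain ⟨a, -, h | h⟩ := move_eq hw hw'
    · rw [h _ (hF.lt _ _), h x hx, h y hy, hF.distrib]
    · rw [h _ (hF.lt _ _), h x hx, h y hy, hF.distrib 0, hF.distrib a]
  have row {w y : ℕ} (hw : w < 27) (hw' : 9 ≤ w) (hy : y < 27) :
      F w y = move w (F 9 (unmove w y)) := by
    rw [move_map hw hw' (by norm_num) (unmove_lt w hw hw' y hy), move_nine w hw hw',
      move_unmove w hw hw' y hy]
  refine ⟨hF.lt 9, fun {L} hL {w y} h => ?_, fun {w y} hw hy => ?_, fun S h0 h1 _ h9 h => ?_⟩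
  · by_cases hwy : w < 27 ∧ y < 27
    · obtain ⟨hw, hy⟩ := hwy
      refine ⟨hw, hy, ?_⟩
      rcases lt_or_ge w 9 with hw' | hw'
      · simp [nineLayout, blt_eq_decide, hw, hy, hw', hr w hw' y hy]
      · by_cases he : entry L (unmove w y) < 27
        · simp [nineLayout, blt_eq_decide, hw, hy, hw'.not_gt, row hw hw' hy, hL _ he, hF.lt]
        · simp [nineLayout, blt_eq_decide, hw, hy, hw'.not_gt, he] at h
    · simp [nineLayout, blt_eq_decide, ← Bool.decide_and, hwy] at h
  · rcases lt_or_ge w 9 with hw' | hw'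
    · simp [nineLayout, blt_eq_decide, hw', hF.idem]
    · simp only [nineLayout, blt_eq_decide, hw'.not_gt, decide_false, cond_false]
      rw [row hw hw' hy, unmove_move w hw hw' _ (hF.lt _ _)]
  · have line (k : ℕ) : k < 9 → S k := by
      induction k using Nat.twoStepInduction with
      | zero => exact fun _ => h0
      | one => exact fun _ => h1
      | more k ih1 ih2 =>
        intro hk
        have e : ∀ k < 9, k + 2 < 9 → reflect (k + 1) k = k + 2 := by decide
        rw [← e k (by omega) hk, ← hr _ (by omega) _ (by omega)]
        exact h _ (by omega) _ (by omega) (ih2 (by omega)) (ih1 (by omega))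
    intro w hw
    rcases lt_or_ge w 9 with hw' | hw'
    · exact line w hw'
    · rw [← move_nine w hw hw']
      obtain ⟨a, ha, e | e⟩ := move_eq hw hw'
      · rw [e 9 (by norm_num)]
        exact h _ (by omega) _ (by norm_num) (line a ha) h9
      · rw [e 9 (by norm_num)]
        exact h _ (by omega) _ (hF.lt _ _) (line a ha)
          (h _ (by norm_num) _ (by norm_num) h0 h9)

theorem exists_isTableIso_of_reflect (hM : ModelConj) (hF : IsTable F)
    (hr : ∀ k < 9, ∀ y < 27, F k y = reflect k y) : ∃ j < 7, ∃ φ, IsTableIso F (model j) φ :=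
  (nineLayout_sound hF hr).check hF hM nineCert
    ((known_zero _).assign (by norm_num) (hF.idem 9 (by norm_num))) (Nat.zero_le _) check_nineCert

theorem commLayout_sound (hF : IsTable F) (hc : ∀ x y, F x y = F y x)
    (hk : ∀ x y, x ≤ y → y < 27 → commKnown x y < 27 → F x y = commKnown x y) :
    commLayout.Sound F (fun i => F (i / 27) (i % 27)) := by
  have cell_eq {w y : ℕ} (hw : w < 27) (hy : y < 27) :
      F (cell w y / 27) (cell w y % 27) = F w y := by
    by_cases h : w ≤ y
    · have : Nat.ble w y = true := by simpa using h
      rw [cell, this, cond_true, show (27 * w + y) / 27 = w by omega,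
        show (27 * w + y) % 27 = y by omega]
    · have : Nat.ble w y = false := by simpa [← Bool.not_eq_true] using h
      rw [cell, this, cond_false, show (27 * y + w) / 27 = y by omega,
        show (27 * y + w) % 27 = w by omega, hc]
  refine ⟨fun _ => hF.lt _ _, fun {L} hL {w y} h => ?_, fun hw hy => cell_eq hw hy,
    fun S h0 h1 h3 h9 h => ?_⟩
  · by_cases hwy : w < 27 ∧ y < 27
    · obtain ⟨hw, hy⟩ := hwy
      have e : commLayout.read L w y = entry L (cell w y) := by
        simp [commLayout, blt_eq_decide, hw, hy]
      rw [e] at h ⊢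
      exact ⟨hw, hy, (hL _ h).trans (cell_eq hw hy)⟩
    · simp [commLayout, blt_eq_decide, ← Bool.decide_and, hwy] at h
  · have step {x y z : ℕ} (hx : S x) (hy : S y) (hxy : x ≤ y := by omega)
        (hy' : y < 27 := by omega) (hz : z < 27 := by omega)
        (e : commKnown x y = z := by decide) : S z := by
      rw [← e, ← hk x y hxy hy' (e.symm ▸ hz)]
      exact h x (by omega) y hy' hx hy
    have h2 : S 2 := step h0 h1
    have h6 : S 6 := step h0 h3
    have h7 : S 7 := step h2 h3
    have h8 : S 8 := step h1 h3
    have h4 : S 4 := step h0 h7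
    have h5 : S 5 := step h0 h8
    have h18 : S 18 := step h0 h9
    have low : ∀ x < 9, S x := fun x hx => by interval_cases x <;> assumption
    have mid : ∀ x < 9, S (9 + x) := fun x hx =>
      step (low x hx) h18 (e := by decide +revert)
    have top : ∀ k < 9, commKnown 0 (9 + k) = 18 + k := by decide
    intro x hx
    by_cases hx1 : x < 9
    · exact low x hx1
    by_cases hx2 : x < 18
    · simpa [show 9 + (x - 9) = x by omega] using mid (x - 9) (by omega)
    · obtain ⟨k, rfl⟩ := Nat.exists_eq_add_of_le (not_lt.1 hx2)
      exact step h0 (mid k (by omega)) (e := top k (by omega))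

theorem known_commInit
    (hk : ∀ x y, x ≤ y → y < 27 → commKnown x y < 27 → F x y = commKnown x y) :
    Known (fun i => F (i / 27) (i % 27)) commInit := by
  rw [commInit]
  have : ∀ i ∈ List.range 729, i < 729 := fun i hi => List.mem_range.1 hi
  generalize List.range 729 = l at *
  induction l with
  | nil => exact known_zero _
  | cons a l ih =>
    have ih := ih fun i hi => this i (List.mem_cons_of_mem _ hi)
    rw [List.foldr_cons]
    cases hb : Nat.ble (a / 27) (a % 27) && Nat.blt (commKnown (a / 27) (a % 27)) 27 with
    | false => exact ih
    | true =>
      rw [Bool.and_eq_true, Nat.ble_eq, Nat.blt_eq] at hb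
      exact ih.assign hb.2 (hk _ _ hb.1 (by omega) hb.2)

theorem exists_isTableIso_of_plane (hM : ModelConj) (hF : IsTable F)
    (hc : ∀ x y, F x y = F y x) (hp : ∀ x y, x ≤ y → y < 9 → F x y = plane x y)
    (h18 : ∀ k < 9, F k 18 = 9 + k) (h0 : ∀ k < 9, F 0 (9 + k) = 18 + k) :
    ∃ j < 7, ∃ φ, IsTableIso F (model j) φ := by
  have hk (x y : ℕ) (hxy : x ≤ y) (hy : y < 27) (hk : commKnown x y < 27) :
      F x y = commKnown x y := by
    unfold commKnown at hk ⊢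
    split_ifs at hk ⊢ with h1 h2 h3 h4 h5 h6 h7
    · rw [← h1, hF.idem x (by omega)]
    · exact hp x y hxy h2
    · rw [h3.1, h18 x h3.2]
    · obtain ⟨k, rfl⟩ := Nat.exists_eq_add_of_le (show 9 ≤ x by omega)
      have := hF.invol 18 k (by omega)
      rw [hc 18 k, h18 k (by omega), hc] at this
      rw [h4.1, this]
      omega
    · obtain ⟨k, rfl⟩ := Nat.exists_eq_add_of_le (show 9 ≤ y by omega)
      rw [h5.1, h0 k (by omega)]
      omega
    · obtain ⟨k, rfl⟩ := Nat.exists_eq_add_of_le (show 18 ≤ y by omega)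
      have := hF.invol 0 (9 + k) (by omega)
      rw [h0 k (by omega)] at this
      rw [h6, this]
      omega
    · rw [h7.1, ← h18 x h7.2, hF.invol _ _ (by norm_num)]
    · omega
  exact (commLayout_sound hF hc hk).check hF hM commCert (known_commInit hk) (Nat.zero_le _)
    check_commCert
end

section
variable {Q : Type*} {m : Q → Q → Q}

theorem translation_mul (hi : ∀ x y, m x (m x y) = y) {x : Q}
    (hx : ∀ y z, m x (m y z) = m (m x y) (m x z)) {y : Q} (z : Q) :
    m (m x y) z = m x (m y (m x z)) := by
  rw [hx, hi]

/-- Left distributivity need only be checked for left factors which generate. -/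
theorem leftDistrib_of_generators [DecidableEq Q] (hi : ∀ x y, m x (m x y) = y) (g : List Q)
    (l : List (Q × Q)) (hg : ∀ x ∈ g, ∀ y z, m x (m y z) = m (m x y) (m x z))
    (hl : ∀ x, x ∈ l.foldl (fun K w => if w.1 ∈ K ∧ w.2 ∈ K then m w.1 w.2 :: K else K) g)
    (x : Q) : ∀ y z, m x (m y z) = m (m x y) (m x z) := by
  replace hl := hl x
  induction l generalizing g with
  | nil => exact hg x hl
  | cons w l ih =>
    rw [List.foldl_cons] at hl
    refine ih _ ?_ hl
    split_ifs with hw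
    · intro x hx
      rcases List.mem_cons.1 hx with rfl | hx
      · intro y z
        have hw1 := hg _ hw.1
        have h := translation_mul hi hw1 (y := w.2)
        rw [h (m y z), h y, h z, hw1 y, hg _ hw.2, hw1]
      · exact hg x hx
    · exact hg

/-- Right translations are injective as soon as one of them is. -/
theorem right_cancel [Finite Q] (hi : ∀ x y, m x (m x y) = y)
    (hd : ∀ x y z, m x (m y z) = m (m x y) (m x z)) {o : Q}
    (ho : Function.Injective fun x => m x o) (y : Q) : Function.Injective fun x => m x y := by
  obtain ⟨c, rfl⟩ := Finite.surjective_of_injective ho y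
  intro a b hab
  have := congrArg (m c) hab
  simp only [hd c a, hd c b, hi] at this
  exact (Function.LeftInverse.injective (hi c)) (ho this)

theorem of_injective [Finite Q] (hi : ∀ x y, m x (m x y) = y) (hm : ∀ x, m x x = x)
    (hd : ∀ x y z, m x (m y z) = m (m x y) (m x z)) {o : Q}
    (ho : Function.Injective fun x => m x o) : IsInvolutoryLatinQuandle m where
  leftBij x := (show Function.Involutive (m x) from hi x).bijective
  rightBij x := Finite.injective_iff_bijective.1 (right_cancel hi hd ho x)
  idem := hm
  leftDistrib := hd
  invol := hi

end

/-- The models as multiplications on `Fin 27`. -/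
def modelFin (j : Fin 7) (x y : Fin 27) : Fin 27 := Fin.ofNat 27 (model j x y)

theorem modelFin_val (j : Fin 7) (x y : Fin 27) : (modelFin j x y : ℕ) = model j x y := by
  have : ∀ j < 7, ∀ x < 27, ∀ y < 27, model j x y < 27 := by decide +kernel
  exact Nat.mod_eq_of_lt (this j j.2 x x.2 y y.2)

/-- Words generating all models from `0`, `1`, `3` and `9`. -/
def generatingWords : List (Fin 27 × Fin 27) :=
  [(0, 1), (0, 3), (2, 3), (1, 3), (0, 7), (0, 8)] ++
    (List.finRange 25).map (fun i => (Fin.ofNat 27 (i + 1), Fin.ofNat 27 i)) ++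
      (List.finRange 9).map (fun i => (Fin.ofNat 27 i, 9)) ++
        (List.finRange 9).map (fun i => (Fin.ofNat 27 i, 18))

theorem isInvolutoryLatinQuandle_modelFin (j : Fin 7) :
    IsInvolutoryLatinQuandle (modelFin j) := by
  have hi : ∀ j : Fin 7, ∀ x y, modelFin j x (modelFin j x y) = y := by decide +kernel
  have hm : ∀ j : Fin 7, ∀ x, modelFin j x x = x := by decide +kernel
  have ho : ∀ j : Fin 7, ∀ x y, modelFin j x 0 = modelFin j y 0 → x = y := by decide +kernel
  have hg : ∀ j : Fin 7, ∀ x ∈ ([0, 1, 3, 9] : List (Fin 27)), ∀ y z,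
      modelFin j x (modelFin j y z) = modelFin j (modelFin j x y) (modelFin j x z) := by
    decide +kernel
  have hl : ∀ j : Fin 7, ∀ x, x ∈ generatingWords.foldl
      (fun K w => if w.1 ∈ K ∧ w.2 ∈ K then modelFin j w.1 w.2 :: K else K) [0, 1, 3, 9] := by
    decide +kernel
  exact of_injective (hi j) (hm j) (leftDistrib_of_generators (hi j) _ _ (hg j) (hl j)) (ho j)

theorem modelConj : ModelConj := fun j hj x hx y hy z hz => by
  have h := isInvolutoryLatinQuandle_modelFin ⟨j, hj⟩
  simpa [modelFin_val] using congrArg Fin.val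
    (translation_mul h.invol (h.leftDistrib ⟨x, hx⟩) (y := ⟨y, hy⟩) ⟨z, hz⟩)

section
variable {Q : Type*} {m : Q → Q → Q}

/-- The left translations as permutations. -/
def translation (h : IsInvolutoryLatinQuandle m) (x : Q) : Equiv.Perm Q :=
  Function.Involutive.toPerm (m x) (h.invol x)

variable (h : IsInvolutoryLatinQuandle m)

theorem translation_apply (x y : Q) : translation h x y = m x y := rfl

theorem translation_mul_self (x : Q) : translation h x * translation h x = 1 :=
  Equiv.ext fun y => h.invol x y

theorem translation_inv (x : Q) : (translation h x)⁻¹ = translation h x :=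
  inv_eq_of_mul_eq_one_left (translation_mul_self h x)

theorem translation_apply_mul (x y : Q) :
    translation h (m x y) = translation h x * translation h y * translation h x :=
  Equiv.ext fun z => translation_mul h.invol (h.leftDistrib x) z

theorem eq_of_mul_eq (h : IsInvolutoryLatinQuandle m) {x w y : Q} (e : m x y = m w y) : x = w :=
  (h.rightBij y).1 e

theorem eq_of_mul_eq_right (h : IsInvolutoryLatinQuandle m) {x z : Q} (e : m x z = z) : x = z :=
  eq_of_mul_eq h (e.trans (h.idem z).symm)

theorem translation_injective : Function.Injective (translation h) := fun x y e =>
  eq_of_mul_eq h (y := x) (by rw [← translation_apply h, e, translation_apply h])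

/-- The product of two left translations. -/
def rotation (c x : Q) : Equiv.Perm Q := translation h c * translation h x

theorem rotation_mul_translation (c x : Q) :
    rotation h c x * translation h x = translation h c := by
  rw [rotation, mul_assoc, translation_mul_self, mul_one]

theorem translation_rotation_pow (c x z : Q) (k : ℕ) :
    translation h ((rotation h c x ^ k) z) =
      rotation h c x ^ k * translation h z * (rotation h c x ^ k)⁻¹ := by
  induction k with
  | zero => simp
  | succ k ih =>
    have e : (rotation h c x ^ (k + 1)) z = m c (m x ((rotation h c x ^ k) z)) := by
      rw [pow_succ', Equiv.Perm.mul_apply]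
      rfl
    rw [e, translation_apply_mul, translation_apply_mul, ih, pow_succ']
    simp only [mul_inv_rev, mul_assoc]
    simp only [rotation, mul_inv_rev, translation_inv, mul_assoc]

theorem translation_mul_rotation_pow (c x : Q) (k : ℕ) :
    translation h x * rotation h c x ^ k = (rotation h c x ^ k)⁻¹ * translation h x := by
  have : SemiconjBy (translation h x) (rotation h c x) (rotation h c x)⁻¹ := by
    rw [SemiconjBy, rotation, mul_inv_rev, translation_inv, translation_inv, mul_assoc]
  rw [← inv_pow]
  exact this.pow_right k

/-- The powers of a product of two left translations act freely. -/
theorem rotation_pow_eq_one (c x : Q) {k : ℕ} {z : Q} (e : (rotation h c x ^ k) z = z) :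
    rotation h c x ^ k = 1 := by
  have key (k : ℕ) : ∃ y, rotation h c x ^ k * translation h x = translation h y := by
    induction k using Nat.twoStepInduction with
    | zero => exact ⟨x, by simp⟩
    | one => exact ⟨c, by rw [pow_one, rotation_mul_translation]⟩
    | more k ih _ =>
      obtain ⟨y, hy⟩ := ih
      refine ⟨m c (m x y), ?_⟩
      rw [translation_apply_mul, translation_apply_mul, ← hy]
      calc rotation h c x ^ (k + 2) * translation h x
          = rotation h c x * rotation h c x ^ k * (rotation h c x * translation h x) := by
            rw [pow_succ, pow_succ', mul_assoc]
        _ = translation h c * translation h x * rotation h c x ^ k *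
              (translation h x * translation h x) * translation h c := by
            rw [rotation_mul_translation, translation_mul_self, mul_one, rotation]
        _ = _ := by simp only [mul_assoc]
  obtain ⟨y, hy⟩ := key k
  have hyx : y = x := eq_of_mul_eq h (y := m x z) (by
    rw [← translation_apply h y, ← hy, Equiv.Perm.mul_apply, translation_apply, h.invol, e])
  rwa [hyx, mul_eq_right] at hy

theorem rotation_pow_eq (c x : Q) {i j : ℕ} {z : Q}
    (e : (rotation h c x ^ i) z = (rotation h c x ^ j) z) :
    rotation h c x ^ i = rotation h c x ^ j := by
  wlog hij : i ≤ j generalizing i j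
  · exact (this e.symm (le_of_not_ge hij)).symm
  obtain ⟨d, rfl⟩ := Nat.exists_eq_add_of_le hij
  rw [pow_add, Equiv.Perm.mul_apply] at e
  rw [pow_add, rotation_pow_eq_one h c x ((rotation h c x ^ i).injective e).symm, mul_one]

theorem orderOf_rotation [Fintype Q] (hQ : Fintype.card Q = 27) {c x : Q} (hc : m c x ≠ m x c) :
    ∃ c x, orderOf (rotation h c x) = 9 := by
  classical
  have : Nonempty Q := ⟨c⟩
  have h3 : rotation h c x ^ 3 = rotation h (m c x) (m x c) := by
    simp only [pow_succ, pow_zero, one_mul, rotation, translation_apply_mul, mul_assoc]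
  have hne : rotation h c x ^ 3 ≠ 1 := by
    intro h1
    rw [h3, rotation, mul_eq_one_iff_eq_inv, translation_inv] at h1
    exact hc (translation_injective h h1)
  have hpos : orderOf (rotation h c x) ≠ 0 := (orderOf_pos _).ne'
  have hle : orderOf (rotation h c x) ≤ 27 := by
    rw [← hQ, ← Fintype.card_fin (orderOf (rotation h c x))]
    refine Fintype.card_le_of_injective (fun i : Fin (orderOf (rotation h c x)) =>
      (rotation h c x ^ (i : ℕ)) x) fun i j hij => Fin.ext ?_
    exact pow_injOn_Iio_orderOf i.2 j.2 (rotation_pow_eq h c x hij)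
  have hp {p : ℕ} (hp : p.Prime) (hd : p ∣ orderOf (rotation h c x)) : p = 3 := by
    have : Fact p.Prime := ⟨hp⟩
    have ho := orderOf_pow_orderOf_div hpos hd
    set k := orderOf (rotation h c x) / p
    have hf : (MulAction.toEndHom (rotation h c x ^ k) : Function.End Q) ^ p ^ 1 = 1 := by
      rw [pow_one, ← map_pow, ← ho, pow_orderOf_eq_one, map_one]
    have hempty : IsEmpty (Function.fixedPoints
        (MulAction.toEndHom (rotation h c x ^ k) : Function.End Q)) := by
      refine ⟨fun z => ?_⟩
      have := rotation_pow_eq_one h c x z.2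
      rw [this, orderOf_one] at ho
      exact hp.one_lt.ne ho
    have hmod := Equiv.Perm.card_fixedPoints_modEq hf
    rw [hQ] at hmod
    have hd : p ∣ 3 ^ 3 :=
      Nat.modEq_zero_iff_dvd.1 (hmod.trans (congrArg (· % p) (Fintype.card_eq_zero_iff.2 hempty)))
    exact (Nat.prime_dvd_prime_iff_eq hp Nat.prime_three).1 (hp.dvd_of_dvd_pow hd)
  have hn := Nat.eq_prime_pow_of_unique_prime_dvd hpos hp
  set t := (orderOf (rotation h c x)).primeFactorsList.length
  have ht : t ≤ 3 := by
    by_contra! ht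
    have := Nat.pow_le_pow_right (show 0 < 3 by norm_num) ht
    omega
  interval_cases t
  · exact absurd (orderOf_dvd_iff_pow_eq_one.1 (by rw [hn]; norm_num)) hne
  · exact absurd (orderOf_dvd_iff_pow_eq_one.1 (by rw [hn]; norm_num)) hne
  · exact ⟨c, x, hn⟩
  · refine ⟨m c x, m x c, ?_⟩
    rw [← h3, orderOf_pow, hn]
    norm_num
end

section
variable {Q : Type*} {m : Q → Q → Q}

/-- A labelling of the elements by the numbers below `27`. -/
structure IsLabelling (lab : ℕ → Q) : Prop where
  inj : ∀ i < 27, ∀ j < 27, lab i = lab j → i = j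
  surj : ∀ q, ∃ i < 27, lab i = q

theorem isLabelling [Fintype Q] (hQ : Fintype.card Q = 27) {lab : ℕ → Q}
    (hl : ∀ i < 27, ∀ j < 27, lab i = lab j → i = j) : IsLabelling lab where
  inj := hl
  surj q := by
    have hb : Function.Bijective fun i : Fin 27 => lab i :=
      (Fintype.bijective_iff_injective_and_card _).2
        ⟨fun i j e => Fin.ext (hl i i.2 j j.2 e), by rw [hQ, Fintype.card_fin]⟩
    obtain ⟨i, hi⟩ := hb.2 q
    exact ⟨i, i.2, hi⟩

theorem IsLabelling.exists_table {lab : ℕ → Q} (hl : IsLabelling lab)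
    (h : IsInvolutoryLatinQuandle m) :
    ∃ F, IsTable F ∧ ∀ x y, lab (F x y) = m (lab x) (lab y) := by
  choose idx hlt hidx using hl.surj
  have hF (x y : ℕ) : lab (idx (m (lab x) (lab y))) = m (lab x) (lab y) := hidx _
  refine ⟨fun x y => idx (m (lab x) (lab y)), ⟨fun x y => hlt _, fun x hx => ?_,
    fun x y z => ?_, fun x y hy => ?_, fun x hx w hw y e => ?_⟩, hF⟩
  · exact hl.inj _ (hlt _) _ hx (by rw [hF, h.idem])
  · exact hl.inj _ (hlt _) _ (hlt _) (by simp only [hidx]; exact h.leftDistrib _ _ _)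
  · exact hl.inj _ (hlt _) _ hy (by simp only [hidx]; exact h.invol _ _)
  · refine hl.inj _ hx _ hw (eq_of_mul_eq h (y := lab y) ?_)
    simpa only [hidx] using congrArg lab e

theorem IsLabelling.exists_equiv {lab : ℕ → Q} (hl : IsLabelling lab) {F : ℕ → ℕ → ℕ}
    (hF : ∀ x y, lab (F x y) = m (lab x) (lab y)) (hlt : ∀ x y, F x y < 27)
    (hm : ∃ j < 7, ∃ φ, IsTableIso F (model j) φ) :
    ∃ j : Fin 7, ∃ φ : Q ≃ Fin 27, ∀ x y, φ (m x y) = modelFin j (φ x) (φ y) := by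
  obtain ⟨j, hj, φ, hφ⟩ := hm
  let e : Fin 27 ≃ Q := Equiv.ofBijective (fun i => lab i)
    ⟨fun i j e => Fin.ext (hl.inj i i.2 j j.2 e), fun q =>
      let ⟨i, hi, hq⟩ := hl.surj q
      ⟨⟨i, hi⟩, hq⟩⟩
  let f : Fin 27 ≃ Fin 27 := Equiv.ofBijective (fun i => ⟨φ i, hφ.lt i i.2⟩)
    (Finite.surjective_iff_bijective.1 fun y =>
      let ⟨i, hi, hy⟩ := hφ.surj y y.2
      ⟨⟨i, hi⟩, Fin.ext hy⟩)
  refine ⟨⟨j, hj⟩, e.symm.trans f, fun x y => ?_⟩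
  obtain ⟨x, rfl⟩ := e.surjective x
  obtain ⟨y, rfl⟩ := e.surjective y
  have hxy : m (e x) (e y) = e ⟨F x y, hlt _ _⟩ := (hF x y).symm
  rw [hxy]
  simp only [Equiv.trans_apply, Equiv.symm_apply_apply]
  exact Fin.ext ((hφ.map x x.2 y y.2).trans (modelFin_val ⟨j, hj⟩ (f x) (f y)).symm)

/-! ### Labelling when some pair does not commute -/

variable (h : IsInvolutoryLatinQuandle m)

theorem mul_rotation_pow (c x z : Q) (k : ℕ) :
    m x ((rotation h c x ^ k) z) = (rotation h c x ^ k)⁻¹ (m x z) :=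
  DFunLike.congr_fun (translation_mul_rotation_pow h c x k) z

theorem rotation_pow_congr {c x : Q} (h9 : orderOf (rotation h c x) = 9) {i j : ℕ}
    (e : i % 9 = j % 9) :
    rotation h c x ^ i = rotation h c x ^ j := by
  rwa [pow_inj_mod, h9]

theorem rotation_pow_inv {c x : Q} (h9 : orderOf (rotation h c x) = 9) (k : ℕ) :
    (rotation h c x ^ k)⁻¹ = rotation h c x ^ (8 * k) := by
  rw [inv_eq_iff_mul_eq_one, ← pow_add, ← pow_zero (rotation h c x)]
  exact rotation_pow_congr h h9 (by omega)

theorem rotation_pow_mul {c x : Q} (h9 : orderOf (rotation h c x) = 9) (z : Q) (k y : ℕ) :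
    m ((rotation h c x ^ k) x) ((rotation h c x ^ y) z) =
      (rotation h c x ^ (2 * k + 8 * y)) (m x z) := by
  rw [← translation_apply h, translation_rotation_pow, rotation_pow_inv h h9, mul_assoc,
    Equiv.Perm.mul_apply, Equiv.Perm.mul_apply, translation_apply, ← Equiv.Perm.mul_apply,
    ← pow_add, mul_rotation_pow h, rotation_pow_inv h h9, ← Equiv.Perm.mul_apply, ← pow_add]
  rw [rotation_pow_congr h h9 (show (k + 8 * (8 * k + y)) % 9 = (2 * k + 8 * y) % 9 by omega)]

/-- The labels determined by two elements and a product of two left translations. -/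
def nineLabel (c x a : Q) (n : ℕ) : Q :=
  (rotation h c x ^ n) (if n < 9 then x else if n < 18 then a else m x a)

theorem nineLabel_mul {c x : Q} (h9 : orderOf (rotation h c x) = 9) (a : Q) {k y : ℕ} (hk : k < 9)
    (hy : y < 27) :
    nineLabel h c x a (reflect k y) = m (nineLabel h c x a k) (nineLabel h c x a y) := by
  rw [nineLabel, nineLabel, nineLabel, if_pos hk, rotation_pow_mul h h9]
  simp only [reflect, blt_eq_decide, Bool.cond_decide]
  split_ifs <;> first
    | omega
    | (try simp only [h.idem, h.invol]
       exact DFunLike.congr_fun (rotation_pow_congr h h9 (by omega)) _)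

theorem nineLabel_injective {c x a : Q} (h9 : orderOf (rotation h c x) = 9)
    (ha : ∀ i : ℕ, (rotation h c x ^ i) x ≠ a) {i j : ℕ} (hi : i < 27) (hj : j < 27)
    (e : nineLabel h c x a i = nineLabel h c x a j) : i = j := by
  have hs (i j : ℕ) (y z : Q) (e : (rotation h c x ^ i) y = (rotation h c x ^ j) z) :
      (rotation h c x ^ (8 * j + i)) y = z := by
    rw [pow_add, Equiv.Perm.mul_apply, e, ← rotation_pow_inv h h9, Equiv.Perm.coe_inv,
      Equiv.symm_apply_apply]
  have h1 (i j : ℕ) : (rotation h c x ^ i) x ≠ (rotation h c x ^ j) a := fun e =>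
    ha _ (hs _ _ _ _ e)
  have h2 (i j : ℕ) : (rotation h c x ^ i) x ≠ (rotation h c x ^ j) (m x a) := fun e => by
    have e := congrArg (m x) (hs _ _ _ _ e)
    rw [h.invol, mul_rotation_pow h, rotation_pow_inv h h9, h.idem] at e
    exact ha _ e
  have h3 (i j : ℕ) : (rotation h c x ^ i) a ≠ (rotation h c x ^ j) (m x a) := fun e => by
    have e := hs _ _ _ _ e.symm
    refine ha _ (eq_of_mul_eq_right h (x := (rotation h c x ^ (5 * (8 * i + j))) x) ?_)
    have := rotation_pow_mul h h9 a (5 * (8 * i + j)) 0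
    rw [pow_zero, Equiv.Perm.one_apply] at this
    rw [this, rotation_pow_congr h h9 (show _ = (8 * i + j) % 9 by omega), e]
  have hp {z : Q} (e : (rotation h c x ^ i) z = (rotation h c x ^ j) z) : i % 9 = j % 9 := by
    have := rotation_pow_eq h c x e
    rwa [pow_inj_mod, h9] at this
  unfold nineLabel at e
  split_ifs at e <;> first
    | exact absurd e (h1 _ _)
    | exact absurd e (h2 _ _)
    | exact absurd e (h3 _ _)
    | exact absurd e.symm (h1 _ _)
    | exact absurd e.symm (h2 _ _)
    | exact absurd e.symm (h3 _ _)
    | (have := hp e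
       omega)

theorem exists_equiv_of_ne (h : IsInvolutoryLatinQuandle m) [Fintype Q]
    (hQ : Fintype.card Q = 27) {x y : Q} (hc : m x y ≠ m y x) :
    ∃ j : Fin 7, ∃ φ : Q ≃ Fin 27, ∀ x y, φ (m x y) = modelFin j (φ x) (φ y) := by
  obtain ⟨c, x, h9⟩ := orderOf_rotation h hQ hc
  obtain ⟨a, ha⟩ : ∃ a, ∀ i : ℕ, (rotation h c x ^ i) x ≠ a := by
    by_contra! hs
    have hs : Function.Surjective fun i : Fin 9 => (rotation h c x ^ (i : ℕ)) x := fun a => by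
      obtain ⟨i, hi⟩ := hs a
      exact ⟨Fin.ofNat 9 i, hi ▸
        DFunLike.congr_fun (rotation_pow_congr h h9 (Nat.mod_mod i 9)) x⟩
    have := Fintype.card_le_of_surjective _ hs
    rw [hQ, Fintype.card_fin] at this
    omega
  have hl : IsLabelling (nineLabel h c x a) :=
    isLabelling hQ fun i hi j hj => nineLabel_injective h h9 ha hi hj
  obtain ⟨F, hF, hmul⟩ := hl.exists_table h
  refine hl.exists_equiv hmul hF.lt (exists_isTableIso_of_reflect modelConj hF fun k hk y hy => ?_)
  refine hl.inj _ (hF.lt k y) _ ?_ ((hmul k y).trans (nineLabel_mul h h9 a hk hy).symm)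
  simp only [reflect, blt_eq_decide, Bool.cond_decide]
  split_ifs <;> omega

end

section
variable {Q : Type*} {m : Q → Q → Q}

/-! ### Labelling when all pairs commute -/

/-- Extend a labelling of a subquandle by the cosets of a further element. -/
def tripleLabel (m : Q → Q → Q) (n : ℕ) (b : Q) (p : ℕ → Q) (k : ℕ) : Q :=
  if k < n then p k else if k < 2 * n then m (p (k - n)) b else m (p 0) (m (p (k - 2 * n)) b)

theorem rightDistrib (h : IsInvolutoryLatinQuandle m) (hc : ∀ x y, m x y = m y x) (x y z : Q) :
    m (m x y) z = m (m x z) (m y z) := by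
  rw [hc, h.leftDistrib, hc z, hc z]

theorem exists_tripleLabel_injective (h : IsInvolutoryLatinQuandle m) (hc : ∀ x y, m x y = m y x)
    [Fintype Q] (hQ : Fintype.card Q = 27) {n : ℕ} (hn : n < 27) {p : ℕ → Q}
    (hp : ∀ i < n, ∀ j < n, p i = p j → i = j)
    (hK : ∀ i < n, ∀ j < n, ∃ k < n, m (p i) (p j) = p k) :
    ∃ b, ∀ i < 3 * n, ∀ j < 3 * n, tripleLabel m n b p i = tripleLabel m n b p j → i = j := by
  obtain ⟨b, hb⟩ : ∃ b, ∀ i < n, p i ≠ b := by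
    by_contra! hs
    have hs : Function.Surjective fun i : Fin n => p i := fun b =>
      let ⟨i, hi, hb⟩ := hs b
      ⟨⟨i, hi⟩, hb⟩
    have := Fintype.card_le_of_surjective _ hs
    rw [hQ, Fintype.card_fin] at this
    omega
  have h1 (i j : ℕ) (hi : i < n) (hj : j < n) : p i ≠ m (p j) b := fun e => by
    obtain ⟨k, hk, e'⟩ := hK j hj i hi
    exact hb k hk (by rw [← e', e, h.invol])
  have h2 (i j : ℕ) (hi : i < n) (hj : j < n) : p i ≠ m (p 0) (m (p j) b) := fun e => by
    obtain ⟨k, hk, e'⟩ := hK 0 (by omega) i hi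
    exact h1 k j hk hj (by rw [← e', e, h.invol])
  have h3 (i j : ℕ) (hi : i < n) (hj : j < n) : m (p i) b ≠ m (p 0) (m (p j) b) := fun e => by
    have e' := rightDistrib h hc (p i) (p j) b
    rw [e, hc (m (p 0) _), hc (p 0), h.invol] at e'
    obtain ⟨k, hk, hk'⟩ := hK i hi j hj
    refine h1 0 k (by omega) hk ?_
    rw [← hk', e']
  refine ⟨b, fun i hi j hj e => ?_⟩
  unfold tripleLabel at e
  split_ifs at e <;> first
    | exact absurd e (h1 _ _ (by omega) (by omega))
    | exact absurd e (h2 _ _ (by omega) (by omega))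
    | exact absurd e (h3 _ _ (by omega) (by omega))
    | exact absurd e.symm (h1 _ _ (by omega) (by omega))
    | exact absurd e.symm (h2 _ _ (by omega) (by omega))
    | exact absurd e.symm (h3 _ _ (by omega) (by omega))
    | exact hp _ (by omega) _ (by omega) e
    | (have := hp _ (by omega) _ (by omega) (eq_of_mul_eq h e)
       omega)
    | (have := hp _ (by omega) _ (by omega) (eq_of_mul_eq h ((h.leftBij _).1 e))
       omega)

theorem tripleLabel_mul (h : IsInvolutoryLatinQuandle m) (hc : ∀ x y, m x y = m y x) {p : ℕ → Q}
    (hp : ∀ x ≤ 2, ∀ y ≤ 2, m (p x) (p y) = p ((2 * x + 2 * y) % 3)) (b : Q) {x y : ℕ}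
    (hxy : x ≤ y) (hy9 : y < 9) :
    m (tripleLabel m 3 b p x) (tripleLabel m 3 b p y) = tripleLabel m 3 b p (plane x y) := by
  have hr := rightDistrib h hc
  have h1 (i j : ℕ) (hi : i ≤ 2) (hj : j ≤ 2) :
      m (m (p i) b) (m (p j) b) = m (p ((2 * i + 2 * j) % 3)) b := by rw [← hr, hp i hi j hj]
  have h2 (j i : ℕ) (hj : j ≤ 2) (hi : i ≤ 2) :
      m (p j) (m (p i) b) = m (p 0) (m (p ((i + 2 * j) % 3)) b) := by
    interval_cases j <;> interval_cases i <;> first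
      | rfl
      | (rw [h.invol]
         exact (h.invol _ _).symm)
      | (rw [h.leftDistrib (p 0), hp 0 (by omega) _ (by omega)]
         done)
      | rw [h.leftDistrib, hp _ (by omega) _ (by omega)]
  have h3 (j i : ℕ) (hj : j ≤ 2) (hi : i ≤ 2) :
      m (p j) (m (p 0) (m (p i) b)) = m (p ((i + j) % 3)) b := by
    rw [← h.invol (p j) (m (p ((i + j) % 3)) b), h2 _ _ hj (by omega),
      show ((i + j) % 3 + 2 * j) % 3 = i by omega]
  have h4 (i j : ℕ) (hi : i ≤ 2) (hj : j ≤ 2) :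
      m (m (p i) b) (m (p 0) (m (p j) b)) = p ((i + 2 * j) % 3) := by
    rw [← h.invol (m (p i) b) (p ((i + 2 * j) % 3)), hc _ (p _), h2 _ _ (by omega) hi,
      show (i + 2 * ((i + 2 * j) % 3)) % 3 = j by omega]
  have l0 (i : ℕ) (hi : i ≤ 2) : tripleLabel m 3 b p i = p i := if_pos (by omega)
  have l1 (i : ℕ) (hi : i ≤ 2) : tripleLabel m 3 b p (3 + i) = m (p i) b := by
    rw [tripleLabel, if_neg (by omega), if_pos (by omega), Nat.add_sub_cancel_left]
  have l2 (i : ℕ) (hi : i ≤ 2) : tripleLabel m 3 b p (6 + i) = m (p 0) (m (p i) b) := by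
    rw [tripleLabel, if_neg (by omega), if_neg (by omega), Nat.add_sub_cancel_left]
  have hk (k : ℕ) (hk : k < 9) : k ≤ 2 ∨ (∃ i ≤ 2, k = 3 + i) ∨ ∃ i ≤ 2, k = 6 + i := by
    rcases lt_or_ge k 3 with h3 | h3
    · exact Or.inl (by omega)
    · rcases lt_or_ge k 6 with h6 | h6
      · exact Or.inr (Or.inl ⟨k - 3, by omega, by omega⟩)
      · exact Or.inr (Or.inr ⟨k - 6, by omega, by omega⟩)
  rcases hk x (by omega) with hx | ⟨i, hx, rfl⟩ | ⟨i, hx, rfl⟩ <;>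
    rcases hk y hy9 with hy | ⟨j, hy, rfl⟩ | ⟨j, hy, rfl⟩
  · rw [l0 x hx, l0 y hy, hp x hx y hy, plane, if_pos (by omega), l0 _ (by omega)]
  · rw [l0 x hx, l1 j hy, h2 x j hx hy, plane, if_neg (by omega), if_pos (by omega),
      if_pos (by omega), l2 _ (by omega), add_assoc, Nat.add_mod_left]
  · rw [l0 x hx, l2 j hy, h3 x j hx hy, plane, if_neg (by omega), if_pos (by omega),
      if_neg (by omega), l1 _ (by omega), show (6 + j + x) % 3 = (j + x) % 3 by omega]
  · omega
  · rw [l1 i hx, l1 j hy, h1 i j hx hy, plane, if_neg (by omega), if_neg (by omega),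
      if_pos (by omega), if_pos (by omega), l1 _ (by omega),
      show (2 * (3 + i) + 2 * (3 + j)) % 3 = (2 * i + 2 * j) % 3 by omega]
  · rw [l1 i hx, l2 j hy, h4 i j hx hy, plane, if_neg (by omega), if_neg (by omega),
      if_pos (by omega), if_neg (by omega), l0 _ (by omega),
      show (3 + i + 2 * (6 + j)) % 3 = (i + 2 * j) % 3 by omega]
  · omega
  · omega
  · rw [l2 i hx, l2 j hy, ← h.leftDistrib, h1 i j hx hy, plane, if_neg (by omega),
      if_neg (by omega), if_neg (by omega), l2 _ (by omega),
      show (2 * (6 + i) + 2 * (6 + j)) % 3 = (2 * i + 2 * j) % 3 by omega]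

theorem exists_equiv_of_comm (h : IsInvolutoryLatinQuandle m) (hc : ∀ x y, m x y = m y x)
    [Fintype Q] (hQ : Fintype.card Q = 27) :
    ∃ j : Fin 7, ∃ φ : Q ≃ Fin 27, ∀ x y, φ (m x y) = modelFin j (φ x) (φ y) := by
  obtain ⟨o⟩ : Nonempty Q := Fintype.card_pos_iff.1 (by omega)
  obtain ⟨x, hx⟩ := exists_tripleLabel_injective h hc hQ (n := 1) (p := fun _ => o) (by norm_num)
    (fun i hi j hj _ => by omega) (fun _ _ _ _ => ⟨0, by norm_num, h.idem o⟩)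
  set p := tripleLabel m 1 x fun _ => o
  have hp (i : ℕ) (hi : i ≤ 2) (j : ℕ) (hj : j ≤ 2) : m (p i) (p j) = p ((2 * i + 2 * j) % 3) := by
    have h12 : m (m o x) (m o (m o x)) = o :=
      (congrArg (m (m o x)) (hc o (m o x))).trans (h.invol _ _)
    interval_cases i <;> interval_cases j
    · exact h.idem _
    · rfl
    · exact h.invol _ _
    · exact hc _ _
    · exact h.idem _
    · exact h12
    · exact (hc _ _).trans (h.invol _ _)
    · exact (hc _ _).trans h12
    · exact h.idem _
  obtain ⟨a, ha⟩ := exists_tripleLabel_injective h hc hQ (n := 3) (p := p) (by norm_num) hx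
    (fun i hi j hj => ⟨_, Nat.mod_lt _ (by norm_num), hp i (by omega) j (by omega)⟩)
  set q := tripleLabel m 3 a p
  have hq (i j : ℕ) (hij : i ≤ j) (hj : j < 9) : m (q i) (q j) = q (plane i j) :=
    tripleLabel_mul h hc hp a hij hj
  have hlt : ∀ i < 9, ∀ j < 9, plane i j < 9 := by decide
  obtain ⟨b, hb⟩ := exists_tripleLabel_injective h hc hQ (n := 9) (p := q) (by norm_num) ha
    (fun i hi j hj => (le_total i j).elim (fun hij => ⟨_, hlt i hi j hj, hq i j hij hj⟩)
      fun hij => ⟨_, hlt j hj i hi, (hc _ _).trans (hq j i hij hi)⟩)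
  have hl := isLabelling hQ hb
  obtain ⟨F, hF, hmul⟩ := hl.exists_table h
  have hF' {x y z : ℕ} (hz : z < 27) (e : m (tripleLabel m 9 b q x) (tripleLabel m 9 b q y) =
      tripleLabel m 9 b q z) : F x y = z :=
    hl.inj _ (hF.lt x y) _ hz ((hmul x y).trans e)
  have l0 (i : ℕ) (hi : i < 9) : tripleLabel m 9 b q i = q i := if_pos hi
  have l1 (i : ℕ) (hi : i < 9) : tripleLabel m 9 b q (9 + i) = m (q i) b := by
    rw [tripleLabel, if_neg (by omega), if_pos (by omega), Nat.add_sub_cancel_left]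
  have l2 (i : ℕ) (hi : i < 9) : tripleLabel m 9 b q (18 + i) = m (q 0) (m (q i) b) := by
    rw [tripleLabel, if_neg (by omega), if_neg (by omega), Nat.add_sub_cancel_left]
  refine hl.exists_equiv hmul hF.lt (exists_isTableIso_of_plane modelConj hF (fun x y => ?_)
    (fun x y hxy hy => ?_) (fun k hk => ?_) fun k hk => ?_)
  · exact hF' (hF.lt y x) ((hc _ _).trans (hmul y x).symm)
  · have := hlt x (by omega) y hy
    exact hF' (by omega) (by rw [l0 x (by omega), l0 y hy, l0 _ this, hq x y hxy hy])
  · refine hF' (by omega) ?_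
    rw [l0 k hk, l1 k hk, show 18 = 18 + 0 from rfl, l2 0 (by omega), h.invol]
  · exact hF' (by omega) (by rw [l0 0 (by omega), l1 k hk, l2 k hk])

end

section
variable {Q R : Type*} [Fintype Q] [DecidableEq Q] [Fintype R] [DecidableEq R]

/-- The number of elements commuting with `o` plus the number of elements `x` such that
`ox * zo = oz * xo` for all `z`. -/
def invariant (m : Q → Q → Q) (o : Q) : ℕ :=
  Fintype.card {x // m o x = m x o} + Fintype.card {x // ∀ z, m (m o x) (m z o) = m (m o z) (m x o)}

theorem invariant_congr {m : Q → Q → Q} {n : R → R → R} (φ : Q ≃ R)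
    (h : ∀ x y, φ (m x y) = n (φ x) (φ y)) (o : Q) : invariant m o = invariant n (φ o) := by
  refine congrArg₂ _ (Fintype.card_congr (φ.subtypeEquiv fun x => ?_))
    (Fintype.card_congr (φ.subtypeEquiv fun x => ?_))
  · simp only [← h, φ.apply_eq_iff_eq]
  · simp only [← h, φ.apply_eq_iff_eq, ← φ.forall_congr_right]

/-- The left translations of a latin quandle are transitive automorphisms. -/
theorem invariant_eq {n : R → R → R} (hn : IsInvolutoryLatinQuandle n) (o p : R) :
    invariant n o = invariant n p := by
  obtain ⟨w, rfl⟩ := (hn.rightBij o).2 p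
  exact invariant_congr (translation hn w) (hn.leftDistrib w) o

end

theorem invariant_modelFin_injective :
    Function.Injective fun j : Fin 7 => invariant (modelFin j) 0 := by
  have (j : Fin 7) : invariant (modelFin j) 0 = ![54, 30, 36, 18, 12, 24, 6] j := by
    revert j
    decide +kernel
  have hinj : Function.Injective ![54, 30, 36, 18, 12, 24, 6] := by decide
  exact fun i j e => hinj (by rw [← this, ← this]; exact e)

theorem exists_equiv {Q : Type*} [Fintype Q] {m : Q → Q → Q} (h : IsInvolutoryLatinQuandle m)
    (hQ : Fintype.card Q = 27) :
    ∃ j : Fin 7, ∃ φ : Q ≃ Fin 27, ∀ x y, φ (m x y) = modelFin j (φ x) (φ y) := by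
  by_cases hc : ∀ x y, m x y = m y x
  · exact exists_equiv_of_comm h hc hQ
  · push Not at hc
    obtain ⟨x, y, hc⟩ := hc
    exact exists_equiv_of_ne h hQ hc

end InvolutoryLatinQuandle

/-- Up to isomorphism (multiplication-preserving bijection), there are exactly
`7` involutory latin quandles of cardinality `27`. -/
theorem involutory_latin_quandles_card_27 :
    Nat.card (Quot (fun m₁ m₂ : {m : Fin 27 → Fin 27 → Fin 27 //
        IsInvolutoryLatinQuandle m} =>
      ∃ φ : Fin 27 ≃ Fin 27, ∀ x y, φ (m₁.1 x y) = m₂.1 (φ x) (φ y))) = 7 := by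
  open InvolutoryLatinQuandle in
  rw [← Nat.card_fin 7]
  symm
  refine Nat.card_congr (Equiv.ofBijective
    (fun j => Quot.mk _ ⟨modelFin j, isInvolutoryLatinQuandle_modelFin j⟩) ⟨fun i j e => ?_, ?_⟩)
  · exact invariant_modelFin_injective (congrArg (Quot.lift (fun m => invariant m.1 0)
      fun _ m₂ ⟨φ, hφ⟩ => (invariant_congr φ hφ 0).trans (invariant_eq m₂.2 _ _)) e)
  · rintro ⟨m, hm⟩
    obtain ⟨j, φ, hφ⟩ := exists_equiv hm (Fintype.card_fin 27)
    exact ⟨j, (Quot.sound ⟨φ, hφ⟩).symm⟩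
end
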